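/- arXiv:2206.09804 — 2 statements merged into one kernel-verified Lean document; each statement's English description precedes it below -/
import Mathlib

section
/- Let S be a cap in F = (Fin 7 → ZMod 3) and let ℓ : F → ZMod 3 be a nonzero linear functional. If the slices S ∩ ℓ⁻¹(1) and S ∩ ℓ⁻¹(2) each have exactly 112 points, then the slice S ∩ ℓ⁻¹(0) has at most 34 points. -/
/-- A cap in the `n`-dimensional affine space over the field of three elements. -/
def IsCap {n : ℕ} (S : Finset (Fin n → ZMod 3)) : Prop :=
  ∀ a ∈ S, ∀ b ∈ S, ∀ c ∈ S, a ≠ b → a ≠ c → b ≠ c → a + b + c ≠ 0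

namespace CapSlice

open Finset

set_option linter.unusedSectionVars false

section Counting
variable {V : Type} [AddCommGroup V] [Module (ZMod 3) V] [Fintype V] [DecidableEq V]

noncomputable instance : Fintype (Module.Dual (ZMod 3) V) :=
  have : Finite (Module.Dual (ZMod 3) V) := DFunLike.finite _
  Fintype.ofFinite _

theorem card_dual : Fintype.card (Module.Dual (ZMod 3) V) = Fintype.card V := by
  rw [Module.card_eq_pow_finrank (K := ZMod 3) (V := V),
    Module.card_eq_pow_finrank (K := ZMod 3) (V := Module.Dual (ZMod 3) V),
    Subspace.dual_finrank_eq]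

theorem zmod3_cases (z : ZMod 3) : z = 0 ∨ z = 1 ∨ z = 2 := by decide +revert

theorem sum_zmod3 {M : Type*} [AddCommMonoid M] (f : ZMod 3 → M) :
    ∑ i, f i = f 0 + f 1 + f 2 := Fin.sum_univ_three f

/-- A nonzero functional takes each value on a third of the space. -/
theorem card_level {M : ℕ} (hM : Fintype.card V = 3 * M) {u : Module.Dual (ZMod 3) V}
    (hu : u ≠ 0) (m : ZMod 3) : #{x | u x = m} = M := by
  obtain ⟨w, hw⟩ : ∃ w, u w = 1 := by
    obtain ⟨w, hw⟩ : ∃ w, u w ≠ 0 := by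
      by_contra! h
      exact hu (LinearMap.ext h)
    exact ⟨(u w)⁻¹ • w, by simp [hw]⟩
  have key : ∀ m : ZMod 3, #{x | u x = m} = #{x | u x = 0} := fun m =>
    Finset.card_bij (fun x _ => x - m • w) (by simp +contextual [hw]) (by simp)
      (fun y hy => ⟨y + m • w, by simpa [hw] using hy, by simp⟩)
  have := Finset.card_eq_sum_card_fiberwise (s := (univ : Finset V)) (t := (univ : Finset (ZMod 3)))
    (f := u) (by simp)
  rw [sum_zmod3, key 1, key 2, card_univ, hM] at this
  rw [key m]
  lia

theorem card_annihilator {M : ℕ} (hM : Fintype.card V = 3 * M) {v : V} (hv : v ≠ 0) :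
    #{u : Module.Dual (ZMod 3) V | u v = 0} = M := by
  classical
  refine card_level (V := Module.Dual (ZMod 3) V) (card_dual.trans hM)
    (u := Module.Dual.eval (ZMod 3) V v) ?_ 0
  rwa [Ne, Module.eval_apply_eq_zero_iff]

theorem sum_card_annihilated {M : ℕ} (hM : Fintype.card V = 3 * M) {ι : Type*}
    (I : Finset ι) (g : ι → V) :
    ∑ u : Module.Dual (ZMod 3) V, #{i ∈ I | u (g i) = 0} = M * #I + 2 * M * #{i ∈ I | g i = 0} := by
  have h (i : ι) : #{u : Module.Dual (ZMod 3) V | u (g i) = 0} =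
      M + 2 * M * if g i = 0 then 1 else 0 := by
    split_ifs with h
    · simp only [h, map_zero, filter_true, card_univ, card_dual, hM]
      ring
    · simp [card_annihilator hM h]
  simp_rw [card_filter]
  rw [sum_comm]
  simp_rw [← card_filter, h, sum_add_distrib, ← mul_sum, sum_const, smul_eq_mul, card_filter]
  ring

/-- The number of points of `S` at which `u` takes the value `m`. -/
def cnt (S : Finset V) (u : Module.Dual (ZMod 3) V) (m : ZMod 3) : ℕ := #{x ∈ S | u x = m}

theorem cnt_sum (S : Finset V) (u : Module.Dual (ZMod 3) V) :
    cnt S u 0 + cnt S u 1 + cnt S u 2 = #S := by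
  have := Finset.card_eq_sum_card_fiberwise (s := S) (t := (univ : Finset (ZMod 3)))
    (f := u) (by simp)
  rw [sum_zmod3] at this
  exact this.symm

theorem card_triples (X Y Z : Finset V) (u : Module.Dual (ZMod 3) V) :
    #{p ∈ X ×ˢ Y ×ˢ Z | u (p.1 + p.2.1 + p.2.2) = 0} =
      ∑ i, ∑ j, cnt X u i * (cnt Y u j * cnt Z u (-i - j)) := by
  rw [Finset.card_eq_sum_card_fiberwise (t := (univ : Finset (ZMod 3 × ZMod 3)))
    (f := fun p => (u p.1, u p.2.1)) (by simp), ← univ_product_univ, sum_product]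
  refine sum_congr rfl fun i _ => sum_congr rfl fun j _ => ?_
  rw [cnt, cnt, cnt, ← card_product, ← card_product]
  congr 1
  ext ⟨p, q, r⟩
  simp only [mem_filter, mem_product, map_add, Prod.mk.injEq]
  constructor
  · rintro ⟨⟨⟨h1, h2, h3⟩, h4⟩, rfl, rfl⟩
    exact ⟨⟨h1, rfl⟩, ⟨h2, rfl⟩, h3, by linear_combination h4⟩
  · rintro ⟨⟨h1, rfl⟩, ⟨h2, rfl⟩, h3, h4⟩
    exact ⟨⟨⟨h1, h2, h3⟩, by rw [h4]; ring⟩, rfl, rfl⟩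

theorem card_pairs (X : Finset V) (u : Module.Dual (ZMod 3) V) :
    #{p ∈ X ×ˢ X | u (p.1 - p.2) = 0} = ∑ i, cnt X u i * cnt X u i := by
  rw [Finset.card_eq_sum_card_fiberwise (t := (univ : Finset (ZMod 3)))
    (f := fun p => u p.1) (by simp)]
  refine sum_congr rfl fun i _ => ?_
  rw [cnt, ← card_product]
  congr 1
  ext ⟨p, q⟩
  simp only [mem_filter, mem_product, map_sub]
  constructor
  · rintro ⟨⟨⟨h1, h2⟩, h4⟩, rfl⟩
    exact ⟨⟨h1, rfl⟩, h2, by linear_combination -h4⟩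
  · rintro ⟨⟨h1, rfl⟩, h2, h4⟩
    exact ⟨⟨⟨h1, h2⟩, by rw [h4]; ring⟩, rfl⟩

/-- Three points of `S` summing to zero coincide. -/
def CapSet (S : Finset V) : Prop := ∀ a ∈ S, ∀ b ∈ S, ∀ c ∈ S, a + b + c = 0 → a = b ∧ b = c

theorem add_self_add_self (a : V) : a + a + a = 0 := by
  have : (3 : ZMod 3) • a = 0 := by
    rw [show (3 : ZMod 3) = 0 from rfl, zero_smul]
  rw [← this, show (3 : ZMod 3) = 1 + 1 + 1 from rfl, add_smul, add_smul, one_smul]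

theorem CapSet.card_zero {S : Finset V} (hS : CapSet S) :
    #{p ∈ S ×ˢ S ×ˢ S | p.1 + p.2.1 + p.2.2 = 0} = #S := by
  refine (Finset.card_bij (fun a _ => (a, a, a)) ?_ ?_ ?_).symm
  · intro a ha
    simpa [ha] using add_self_add_self a
  · simp
  · rintro ⟨a, b, c⟩ h
    simp only [mem_filter, mem_product] at h
    obtain ⟨rfl, rfl⟩ := hS a h.1.1 b h.1.2.1 c h.1.2.2 h.2
    exact ⟨a, h.1.1, rfl⟩

theorem card_diag (S : Finset V) : #{p ∈ S ×ˢ S | p.1 - p.2 = 0} = #S := by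
  refine (Finset.card_bij (fun a _ => (a, a)) ?_ ?_ ?_).symm
  · simp
  · simp
  · rintro ⟨a, b⟩ h
    simp only [mem_filter, mem_product, sub_eq_zero] at h
    exact ⟨a, h.1.1, by rw [← h.2]⟩

/-- The quadratic and cubic moments of a triple, and the trilinear moment of three triples. -/
def sq (a b c : ℕ) : ℕ := Nat.add (Nat.mul a a) (Nat.add (Nat.mul b b) (Nat.mul c c))

def cu (a b c : ℕ) : ℕ :=
  Nat.add (Nat.mul a (Nat.mul a a)) (Nat.add (Nat.mul b (Nat.mul b b)) (Nat.add
    (Nat.mul c (Nat.mul c c)) (Nat.mul 6 (Nat.mul a (Nat.mul b c)))))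

def tri (a b c : ZMod 3 → ℕ) : ℕ := ∑ i, ∑ j, a i * (b j * c (-i - j))

theorem sum_sq {M : ℕ} (hM : Fintype.card V = 3 * M) (S : Finset V) :
    ∑ u, sq (cnt S u 0) (cnt S u 1) (cnt S u 2) = M * (#S * #S + 2 * #S) := by
  have := sum_card_annihilated hM (S ×ˢ S) fun p => p.1 - p.2
  simp_rw [card_pairs, sum_zmod3, card_diag, card_product] at this
  simp only [sq, Nat.add_eq, Nat.mul_eq, ← add_assoc]
  rw [this]
  ring

theorem sum_tri {M : ℕ} (hM : Fintype.card V = 3 * M) {X Y Z : Finset V}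
    (h : ∀ x ∈ X, ∀ y ∈ Y, ∀ z ∈ Z, x + y + z ≠ 0) :
    ∑ u, tri (cnt X u) (cnt Y u) (cnt Z u) = M * (#X * #Y * #Z) := by
  have h1 := sum_card_annihilated hM (X ×ˢ Y ×ˢ Z) fun p => p.1 + p.2.1 + p.2.2
  have h0 : #{p ∈ X ×ˢ Y ×ˢ Z | p.1 + p.2.1 + p.2.2 = 0} = 0 := by
    rw [card_eq_zero, filter_eq_empty_iff]
    rintro ⟨x, y, z⟩ hp
    simp only [mem_product] at hp
    exact h x hp.1 y hp.2.1 z hp.2.2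
  simp_rw [card_triples, h0, card_product] at h1
  simp only [tri]
  rw [h1]
  ring

theorem tri_self (a : ZMod 3 → ℕ) : tri a a a = cu (a 0) (a 1) (a 2) := by
  simp only [tri, sum_zmod3, cu, Nat.add_eq, Nat.mul_eq]
  have e1 : (-0 - 0 : ZMod 3) = 0 := rfl
  have e2 : (-0 - 1 : ZMod 3) = 2 := rfl
  have e3 : (-0 - 2 : ZMod 3) = 1 := rfl
  have e4 : (-1 - 0 : ZMod 3) = 2 := rfl
  have e5 : (-1 - 1 : ZMod 3) = 1 := rfl
  have e6 : (-1 - 2 : ZMod 3) = 0 := rfl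
  have e7 : (-2 - 0 : ZMod 3) = 1 := rfl
  have e8 : (-2 - 1 : ZMod 3) = 0 := rfl
  have e9 : (-2 - 2 : ZMod 3) = 2 := rfl
  rw [e1, e2, e3, e4, e5, e6, e7, e8, e9]
  ring

theorem CapSet.sum_cu {M : ℕ} (hM : Fintype.card V = 3 * M) {S : Finset V} (hS : CapSet S) :
    ∑ u, cu (cnt S u 0) (cnt S u 1) (cnt S u 2) = M * (#S * #S * #S + 2 * #S) := by
  have h1 := sum_card_annihilated hM (S ×ˢ S ×ˢ S) fun p => p.1 + p.2.1 + p.2.2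
  simp_rw [card_triples, hS.card_zero, card_product] at h1
  simp only [← tri_self]
  simp only [tri]
  rw [h1]
  ring

end Counting

/-- Nonnegative weights of the moments of a triple of triples. -/
structure Weights where
  one : ℕ
  sqa : ℕ
  cua : ℕ
  sqb : ℕ
  cub : ℕ
  sqc : ℕ
  cuc : ℕ
  tri : ℕ

namespace Weights

def eval (w : Weights) (a b c : ZMod 3 → ℕ) : ℕ :=
  w.one + w.sqa * sq (a 0) (a 1) (a 2) + w.cua * cu (a 0) (a 1) (a 2) +
    w.sqb * sq (b 0) (b 1) (b 2) + w.cub * cu (b 0) (b 1) (b 2) +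
    w.sqc * sq (c 0) (c 1) (c 2) + w.cuc * cu (c 0) (c 1) (c 2) + w.tri * CapSlice.tri a b c

/-- The sum of `eval` over the dual of a space with `3 * M` points, for slices of a cap
of sizes `x`, `y`, `z`. -/
def total (w : Weights) (M x y z : ℕ) : ℕ :=
  M * (3 * w.one + w.sqa * (x * x + 2 * x) + w.cua * (x * x * x + 2 * x) +
    w.sqb * (y * y + 2 * y) + w.cub * (y * y * y + 2 * y) +
    w.sqc * (z * z + 2 * z) + w.cuc * (z * z * z + 2 * z) + w.tri * (x * y * z))

/-- The value of `eval` at functionals that are constant on each slice. -/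
def const (w : Weights) (x y z : ℕ) : ℕ :=
  w.one + w.sqa * (x * x) + w.cua * (x * x * x) + w.sqb * (y * y) + w.cub * (y * y * y) +
    w.sqc * (z * z) + w.cuc * (z * z * z) + w.tri * (x * y * z)

end Weights

section Duality
variable {V : Type} [AddCommGroup V] [Module (ZMod 3) V] [Fintype V] [DecidableEq V]

/-- The slice of `S` on which `χ` takes the value `i`. -/
def row (S : Finset V) (χ : Module.Dual (ZMod 3) V) (i : ZMod 3) : Finset V := {x ∈ S | χ x = i}

theorem mem_row {S : Finset V} {χ : Module.Dual (ZMod 3) V} {i : ZMod 3} {x : V} :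
    x ∈ row S χ i ↔ x ∈ S ∧ χ x = i := by simp [row]

theorem card_row (S : Finset V) (χ : Module.Dual (ZMod 3) V) (i : ZMod 3) :
    #(row S χ i) = cnt S χ i := rfl

theorem CapSet.mono {S T : Finset V} (hS : CapSet S) (h : T ⊆ S) : CapSet T :=
  fun a ha b hb c hc => hS a (h ha) b (h hb) c (h hc)

theorem CapSet.row {S : Finset V} (hS : CapSet S) (χ : Module.Dual (ZMod 3) V) (i : ZMod 3) :
    CapSet (row S χ i) := hS.mono (filter_subset _ _)

/-- `χ` and `u` are linearly independent: they take all pairs of values. -/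
def Indep (χ u : Module.Dual (ZMod 3) V) : Prop := ∀ i m, ∃ v, χ v = i ∧ u v = m

theorem exists_eq_one {u : Module.Dual (ZMod 3) V} (hu : u ≠ 0) : ∃ w, u w = 1 := by
  obtain ⟨w, hw⟩ : ∃ w, u w ≠ 0 := by
    by_contra! h
    exact hu (LinearMap.ext h)
  exact ⟨(u w)⁻¹ • w, by simp [hw]⟩

theorem indep_or {χ : Module.Dual (ZMod 3) V} (hχ : χ ≠ 0) (u : Module.Dual (ZMod 3) V) :
    Indep χ u ∨ u = 0 ∨ u = χ ∨ u = -χ := by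
  obtain ⟨w, hw⟩ := exists_eq_one hχ
  by_cases h : ∃ v, χ v = 0 ∧ u v ≠ 0
  · obtain ⟨v, h1, h2⟩ := h
    refine .inl fun i m => ⟨i • w + ((m - i * u w) * (u v)⁻¹) • v, by simp [hw, h1], ?_⟩
    simp [h2]
  · push Not at h
    have key (x : V) : u x = u w * χ x := by
      have := h (x - χ x • w) (by simp [hw])
      rw [map_sub, map_smul, smul_eq_mul, sub_eq_zero] at this
      rw [this, mul_comm]
    refine .inr ?_
    rcases zmod3_cases (u w) with h0 | h0 | h0 <;> rw [h0] at key
    · exact .inl (LinearMap.ext fun x => by simp [key])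
    · exact .inr (.inl (LinearMap.ext fun x => by simp [key]))
    · exact .inr (.inr (LinearMap.ext fun x => by
        rw [key, LinearMap.neg_apply, show (2 : ZMod 3) = -1 from rfl, neg_one_mul]))

theorem Indep.ne {χ u : Module.Dual (ZMod 3) V} (h : Indep χ u) : u ≠ 0 ∧ u ≠ χ ∧ u ≠ -χ := by
  obtain ⟨v, h1, h2⟩ := h 0 1
  refine ⟨?_, ?_, ?_⟩ <;> rintro rfl
  · simp at h2
  · simp [h1] at h2
  · simp [h1] at h2

theorem Indep.ne_zero_left {χ u : Module.Dual (ZMod 3) V} (h : Indep χ u) : χ ≠ 0 := by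
  rintro rfl
  obtain ⟨v, h1, h2⟩ := h 1 1
  simp at h1

theorem Indep.symm {χ u : Module.Dual (ZMod 3) V} (h : Indep χ u) : Indep u χ := fun i m =>
  (h m i).imp fun _ => And.symm

theorem Indep.add_smul {χ u : Module.Dual (ZMod 3) V} (h : Indep χ u) (r : ZMod 3) :
    Indep χ (u + r • χ) := fun i m => by
  obtain ⟨v, rfl, h2⟩ := h i (m - r * i)
  exact ⟨v, rfl, by simp [h2]⟩

theorem neg_ne_self {χ : Module.Dual (ZMod 3) V} (h : χ ≠ 0) : χ ≠ -χ := fun he => by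
  obtain ⟨w, hw⟩ := exists_eq_one h
  have := congrArg (· w) he
  simp [hw] at this
  revert this
  decide

theorem sum_eval {M : ℕ} (hM : Fintype.card V = 3 * M) {S : Finset V} (hS : CapSet S)
    (χ : Module.Dual (ZMod 3) V) (w : Weights) :
    ∑ u, w.eval (cnt (row S χ 0) u) (cnt (row S χ 1) u) (cnt (row S χ 2) u) =
      w.total M (cnt S χ 0) (cnt S χ 1) (cnt S χ 2) := by
  have ht : ∀ x ∈ row S χ 0, ∀ y ∈ row S χ 1, ∀ z ∈ row S χ 2, x + y + z ≠ 0 := by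
    intro x hx y hy z hz h
    rw [mem_row] at hx hy hz
    have := (hS x hx.1 y hy.1 z hz.1 h).1
    rw [this, hy.2] at hx
    exact one_ne_zero hx.2
  simp only [Weights.eval, sum_add_distrib, ← mul_sum, sum_sq hM, (hS.row χ _).sum_cu hM,
    sum_tri hM ht, card_row, sum_const, card_univ, card_dual, hM, Weights.total, smul_eq_mul]
  ring

theorem cnt_row_self (S : Finset V) (χ : Module.Dual (ZMod 3) V) (r i m : ZMod 3) :
    cnt (row S χ i) (r • χ) m = if r * i = m then cnt S χ i else 0 := by
  rw [cnt, row, filter_filter]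
  split_ifs with h
  · rw [cnt]
    congr 1
    ext x
    simp only [mem_filter, LinearMap.smul_apply, smul_eq_mul, and_congr_right_iff, and_iff_left_iff_imp]
    rintro - rfl
    exact h
  · rw [card_eq_zero, filter_eq_empty_iff]
    rintro x - ⟨rfl, h'⟩
    exact h h'

theorem tri_eq (a b c : ZMod 3 → ℕ) : tri a b c =
    c 0 * (a 0 * b 0 + a 1 * b 2 + a 2 * b 1) + c 1 * (a 0 * b 2 + a 1 * b 1 + a 2 * b 0) +
    c 2 * (a 0 * b 1 + a 1 * b 0 + a 2 * b 2) := by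
  simp only [tri, sum_zmod3]
  have e1 : (-0 - 0 : ZMod 3) = 0 := rfl
  have e2 : (-0 - 1 : ZMod 3) = 2 := rfl
  have e3 : (-0 - 2 : ZMod 3) = 1 := rfl
  have e4 : (-1 - 0 : ZMod 3) = 2 := rfl
  have e5 : (-1 - 1 : ZMod 3) = 1 := rfl
  have e6 : (-1 - 2 : ZMod 3) = 0 := rfl
  have e7 : (-2 - 0 : ZMod 3) = 1 := rfl
  have e8 : (-2 - 1 : ZMod 3) = 0 := rfl
  have e9 : (-2 - 2 : ZMod 3) = 2 := rfl
  rw [e1, e2, e3, e4, e5, e6, e7, e8, e9]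
  ring

theorem eval_smul (S : Finset V) (χ : Module.Dual (ZMod 3) V) (w : Weights) (r : ZMod 3) :
    w.eval (cnt (row S χ 0) (r • χ)) (cnt (row S χ 1) (r • χ)) (cnt (row S χ 2) (r • χ)) =
      w.const (cnt S χ 0) (cnt S χ 1) (cnt S χ 2) := by
  have e1 : (1 : ZMod 3) ≠ 0 := by decide
  have e2 : (2 : ZMod 3) ≠ 0 := by decide
  have e3 : (1 : ZMod 3) ≠ 2 := by decide
  have e4 : (2 : ZMod 3) * 2 = 1 := rfl
  simp only [Weights.eval, Weights.const, tri_eq, cnt_row_self, sq, cu, Nat.add_eq, Nat.mul_eq]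
  rcases zmod3_cases r with rfl | rfl | rfl <;>
    simp [e1, e2, e3, e1.symm, e2.symm, e3.symm, e4] <;> ring

/-- Weak linear-programming duality for the family of slice matrices in a fixed direction. -/
theorem duality {M : ℕ} (hM : Fintype.card V = 3 * M) {S : Finset V} (hS : CapSet S)
    {χ : Module.Dual (ZMod 3) V} (hχ : χ ≠ 0) (p q : Weights)
    (h : ∀ u, Indep χ u →
      q.eval (cnt (row S χ 0) u) (cnt (row S χ 1) u) (cnt (row S χ 2) u) ≤
        p.eval (cnt (row S χ 0) u) (cnt (row S χ 1) u) (cnt (row S χ 2) u)) :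
    q.total M (cnt S χ 0) (cnt S χ 1) (cnt S χ 2) +
        3 * p.const (cnt S χ 0) (cnt S χ 1) (cnt S χ 2) ≤
      p.total M (cnt S χ 0) (cnt S χ 1) (cnt S χ 2) +
        3 * q.const (cnt S χ 0) (cnt S χ 1) (cnt S χ 2) ∧
    ∀ u, Indep χ u →
      p.eval (cnt (row S χ 0) u) (cnt (row S χ 1) u) (cnt (row S χ 2) u) +
        (q.total M (cnt S χ 0) (cnt S χ 1) (cnt S χ 2) +
        3 * p.const (cnt S χ 0) (cnt S χ 1) (cnt S χ 2)) ≤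
      q.eval (cnt (row S χ 0) u) (cnt (row S χ 1) u) (cnt (row S χ 2) u) +
      (p.total M (cnt S χ 0) (cnt S χ 1) (cnt S χ 2) +
        3 * q.const (cnt S χ 0) (cnt S χ 1) (cnt S χ 2)) := by
  classical
  set F : Weights → Module.Dual (ZMod 3) V → ℕ := fun w u =>
    w.eval (cnt (row S χ 0) u) (cnt (row S χ 1) u) (cnt (row S χ 2) u)
  have hnot : (univ.filter fun u => ¬ Indep χ u) = {0, χ, -χ} := by
    ext u
    simp only [mem_filter, mem_univ, true_and, mem_insert, mem_singleton]
    constructor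
    · intro hu
      exact (indep_or hχ u).resolve_left hu
    · rintro hu hi
      have := hi.ne
      tauto
  have hs (w : Weights) : ∑ u with Indep χ u, F w u +
      3 * w.const (cnt S χ 0) (cnt S χ 1) (cnt S χ 2) =
      w.total M (cnt S χ 0) (cnt S χ 1) (cnt S χ 2) := by
    rw [← sum_eval hM hS χ w, ← sum_filter_add_sum_filter_not univ (fun u => Indep χ u), hnot,
      sum_insert (by simp [hχ, hχ.symm]), sum_insert (by simpa using neg_ne_self hχ), sum_singleton]
    have h0 := eval_smul S χ w 0
    have h1 := eval_smul S χ w 1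
    have h2 := eval_smul S χ w (-1)
    rw [zero_smul] at h0
    rw [one_smul] at h1
    rw [show (-1 : ZMod 3) • χ = -χ from LinearMap.ext fun v => by simp] at h2
    rw [h0, h1, h2]
    ring
  have hp := hs p
  have hq := hs q
  have hle : ∀ u ∈ univ.filter fun u => Indep χ u, F q u ≤ F p u := by simpa using h
  refine ⟨?_, fun u hu => ?_⟩
  · have := sum_le_sum hle
    lia
  · have hu' : u ∈ univ.filter fun u => Indep χ u := by simpa using hu
    have h1 := sum_erase_add _ (F p) hu'
    have h2 := sum_erase_add _ (F q) hu'
    have h3 := sum_le_sum (s := (univ.filter fun u => Indep χ u).erase u)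
      fun v hv => hle v (mem_of_mem_erase hv)
    change F p u + _ ≤ F q u + _
    lia

/-- Weak linear-programming duality for the slices of a single cap. -/
theorem duality_one {M : ℕ} (hM : Fintype.card V = 3 * M) {S : Finset V} (hS : CapSet S)
    (p0 p1 p2 q0 q1 q2 : ℕ)
    (h : ∀ u ≠ 0, q0 + q1 * sq (cnt S u 0) (cnt S u 1) (cnt S u 2) +
        q2 * cu (cnt S u 0) (cnt S u 1) (cnt S u 2) ≤
      p0 + p1 * sq (cnt S u 0) (cnt S u 1) (cnt S u 2) +
        p2 * cu (cnt S u 0) (cnt S u 1) (cnt S u 2)) :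
    (M * (3 * q0 + q1 * (#S * #S + 2 * #S) + q2 * (#S * #S * #S + 2 * #S)) +
        (p0 + p1 * (#S * #S) + p2 * (#S * #S * #S)) ≤
      M * (3 * p0 + p1 * (#S * #S + 2 * #S) + p2 * (#S * #S * #S + 2 * #S)) +
        (q0 + q1 * (#S * #S) + q2 * (#S * #S * #S))) ∧
    ∀ u ≠ 0,
      p0 + p1 * sq (cnt S u 0) (cnt S u 1) (cnt S u 2) +
        p2 * cu (cnt S u 0) (cnt S u 1) (cnt S u 2) +
      (M * (3 * q0 + q1 * (#S * #S + 2 * #S) + q2 * (#S * #S * #S + 2 * #S)) +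
        (p0 + p1 * (#S * #S) + p2 * (#S * #S * #S))) ≤
      q0 + q1 * sq (cnt S u 0) (cnt S u 1) (cnt S u 2) +
        q2 * cu (cnt S u 0) (cnt S u 1) (cnt S u 2) +
      (M * (3 * p0 + p1 * (#S * #S + 2 * #S) + p2 * (#S * #S * #S + 2 * #S)) +
        (q0 + q1 * (#S * #S) + q2 * (#S * #S * #S))) := by
  classical
  set F : ℕ → ℕ → ℕ → Module.Dual (ZMod 3) V → ℕ := fun w0 w1 w2 u =>
    w0 + w1 * sq (cnt S u 0) (cnt S u 1) (cnt S u 2) +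
      w2 * cu (cnt S u 0) (cnt S u 1) (cnt S u 2) with hF
  have hs (w0 w1 w2 : ℕ) : ∑ u ∈ univ.erase 0, F w0 w1 w2 u +
      (w0 + w1 * (#S * #S) + w2 * (#S * #S * #S)) =
      M * (3 * w0 + w1 * (#S * #S + 2 * #S) + w2 * (#S * #S * #S + 2 * #S)) := by
    have h0 : F w0 w1 w2 0 = w0 + w1 * (#S * #S) + w2 * (#S * #S * #S) := by
      have e1 : (0 : ZMod 3) ≠ 1 := by decide
      have e2 : (0 : ZMod 3) ≠ 2 := by decide
      have c0 : cnt S 0 0 = #S := by simp [cnt]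
      have c1 : cnt S 0 1 = 0 := by simp [cnt, e1]
      have c2 : cnt S 0 2 = 0 := by simp [cnt, e2]
      simp only [hF, c0, c1, c2, sq, cu, Nat.add_eq, Nat.mul_eq]
      ring
    rw [← h0, sum_erase_add _ _ (mem_univ _)]
    simp only [hF, sum_add_distrib, ← mul_sum, sum_sq hM, hS.sum_cu hM, sum_const, card_univ,
      card_dual, hM, smul_eq_mul]
    ring
  have hp := hs p0 p1 p2
  have hq := hs q0 q1 q2
  have hle : ∀ u ∈ univ.erase (0 : Module.Dual (ZMod 3) V), F q0 q1 q2 u ≤ F p0 p1 p2 u := by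
    simpa using h
  refine ⟨?_, fun u hu => ?_⟩
  · have := sum_le_sum hle
    lia
  · have hu' : u ∈ univ.erase (0 : Module.Dual (ZMod 3) V) := by simpa using hu
    have h1 := sum_erase_add _ (F p0 p1 p2) hu'
    have h2 := sum_erase_add _ (F q0 q1 q2) hu'
    have h3 := sum_le_sum (s := (univ.erase 0).erase u)
      fun v hv => hle v (mem_of_mem_erase hv)
    change F p0 p1 p2 u + _ ≤ F q0 q1 q2 u + _
    lia

end Duality

/-! ### Kernel-friendly enumeration of slice matrices -/

/-- `p k` holds for all `k < n`. -/
def allB (n : ℕ) (p : ℕ → Bool) : Bool := Nat.rec true (fun k r => and (p k) r) n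

/-- `k n`, arranged so that the kernel evaluates `n` first. -/
def force (n : ℕ) (k : ℕ → Bool) : Bool := Nat.rec (k 0) (fun m _ => k (Nat.succ m)) n

theorem allB_iff {n : ℕ} {p : ℕ → Bool} : allB n p = true ↔ ∀ k < n, p k = true := by
  induction n with
  | zero => simp [allB]
  | succ n ih =>
    change (p n && allB n p) = true ↔ _
    rw [Bool.and_eq_true, ih, Nat.forall_lt_succ_right, and_comm]

theorem force_eq (n : ℕ) (k : ℕ → Bool) : force n k = k n := by cases n <;> rfl

def mx (a b : ℕ) : ℕ := cond (Nat.ble a b) b a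

theorem mx_le {a b c : ℕ} : mx a b ≤ c ↔ a ≤ c ∧ b ≤ c := by
  unfold mx
  cases h : Nat.ble a b
  · have : ¬ a ≤ b := by simp [← Nat.ble_eq, h]
    simp only [cond_false]
    lia
  · have : a ≤ b := by simpa [← Nat.ble_eq] using h
    simp only [cond_true]
    lia

abbrev TripleTest := ℕ → ℕ → ℕ → Bool

/-- Certifies `q.eval ≤ p.eval` on all admissible slice matrices with slice sizes `x`, `y`, `z`. -/
def check (nrm : Bool) (x y z T : ℕ) (R F₀ F₁ : TripleTest) (p q : Weights) : Bool :=
  allB (Nat.succ x) fun a0 => allB (cond nrm (Nat.succ a0) (Nat.succ x)) fun a1 =>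
  force (Nat.sub (Nat.sub x a0) a1) fun a2 =>
    !((!nrm || Nat.ble a2 a0) && Nat.beq (Nat.add a0 (Nat.add a1 a2)) x && R a0 a1 a2) ||
  allB (Nat.succ y) fun b0 => allB (cond nrm (Nat.succ b0) (Nat.succ y)) fun b1 =>
  force (Nat.sub (Nat.sub y b0) b1) fun b2 =>
    !((!nrm || Nat.ble b2 b0) && Nat.beq (Nat.add b0 (Nat.add b1 b2)) y && R b0 b1 b2) ||
  force (Nat.sub T (mx (Nat.add a0 b0) (mx (Nat.add a1 b2) (Nat.add a2 b1)))) fun m0 =>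
  force (Nat.sub T (mx (Nat.add a0 b2) (mx (Nat.add a1 b1) (Nat.add a2 b0)))) fun m1 =>
  force (Nat.sub T (mx (Nat.add a0 b1) (mx (Nat.add a1 b0) (Nat.add a2 b2)))) fun m2 =>
  force (Nat.add (Nat.mul a0 b0) (Nat.add (Nat.mul a1 b2) (Nat.mul a2 b1))) fun d0 =>
  force (Nat.add (Nat.mul a0 b2) (Nat.add (Nat.mul a1 b1) (Nat.mul a2 b0))) fun d1 =>
  force (Nat.add (Nat.mul a0 b1) (Nat.add (Nat.mul a1 b0) (Nat.mul a2 b2))) fun d2 =>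
  force (Nat.add p.one (Nat.add (Nat.mul p.sqa (sq a0 a1 a2)) (Nat.add (Nat.mul p.cua (cu a0 a1 a2))
    (Nat.add (Nat.mul p.sqb (sq b0 b1 b2)) (Nat.mul p.cub (cu b0 b1 b2)))))) fun e =>
  force (Nat.add q.one (Nat.add (Nat.mul q.sqa (sq a0 a1 a2)) (Nat.add (Nat.mul q.cua (cu a0 a1 a2))
    (Nat.add (Nat.mul q.sqb (sq b0 b1 b2)) (Nat.mul q.cub (cu b0 b1 b2)))))) fun g =>
  allB (Nat.succ m0) fun c0 => force (Nat.sub (Nat.sub z c0) m2) fun l =>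
  allB (Nat.sub (Nat.succ m1) l) fun t => force (Nat.add l t) fun c1 =>
  force (Nat.sub (Nat.sub z c0) c1) fun c2 =>
    Nat.ble
      (Nat.add g (Nat.add (Nat.mul q.sqc (sq c0 c1 c2)) (Nat.add (Nat.mul q.cuc (cu c0 c1 c2))
        (Nat.mul q.tri (Nat.add (Nat.mul c0 d0) (Nat.add (Nat.mul c1 d1) (Nat.mul c2 d2)))))))
      (Nat.add e (Nat.add (Nat.mul p.sqc (sq c0 c1 c2)) (Nat.add (Nat.mul p.cuc (cu c0 c1 c2))
        (Nat.mul p.tri (Nat.add (Nat.mul c0 d0) (Nat.add (Nat.mul c1 d1) (Nat.mul c2 d2))))))) ||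
    !(Nat.beq (Nat.add c0 (Nat.add c1 c2)) z && R c0 c1 c2 && R a0 b0 c0 && R a1 b2 c0 &&
      R a2 b1 c0 && R a0 b2 c1 && R a1 b1 c1 && R a2 b0 c1 && R a0 b1 c2 && R a1 b0 c2 &&
      R a2 b2 c2 &&
      F₀ (Nat.add a0 (Nat.add b0 c0)) (Nat.add a1 (Nat.add b1 c1)) (Nat.add a2 (Nat.add b2 c2)) &&
      F₁ (Nat.add a0 (Nat.add b1 c2)) (Nat.add a1 (Nat.add b2 c0)) (Nat.add a2 (Nat.add b0 c1)) &&
      F₁ (Nat.add a0 (Nat.add b2 c1)) (Nat.add a1 (Nat.add b0 c2)) (Nat.add a2 (Nat.add b1 c0)))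

/-- The constraints on the slice matrix of a cap: rows and transversals satisfy `R`, the
triples of diagonal sums satisfy `F₀` and `F₁`. -/
structure Admissible (x y z : ℕ) (R F₀ F₁ : TripleTest) (a b c : ZMod 3 → ℕ) : Prop where
  suma : a 0 + a 1 + a 2 = x
  sumb : b 0 + b 1 + b 2 = y
  sumc : c 0 + c 1 + c 2 = z
  rowa : R (a 0) (a 1) (a 2) = true
  rowb : R (b 0) (b 1) (b 2) = true
  rowc : R (c 0) (c 1) (c 2) = true
  trans : ∀ i j, R (a i) (b j) (c (-i - j)) = true
  diag0 : F₀ (a 0 + b 0 + c 0) (a 1 + b 1 + c 1) (a 2 + b 2 + c 2) = true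
  diag1 : F₁ (a 0 + b 1 + c 2) (a 1 + b 2 + c 0) (a 2 + b 0 + c 1) = true
  diag2 : F₁ (a 0 + b 2 + c 1) (a 1 + b 0 + c 2) (a 2 + b 1 + c 0) = true

theorem le_of_check_aux {nrm : Bool} {x y z T : ℕ} {R F₀ F₁ : TripleTest} {p q : Weights}
    (hT : ∀ u v w, R u v w = true → u + v + w ≤ T)
    (h : check nrm x y z T R F₀ F₁ p q = true) {a b c : ZMod 3 → ℕ}
    (hc : Admissible x y z R F₀ F₁ a b c)
    (hn : nrm = true → a 1 ≤ a 0 ∧ a 2 ≤ a 0 ∧ b 1 ≤ b 0 ∧ b 2 ≤ b 0) :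
    q.eval a b c ≤ p.eval a b c := by
  obtain ⟨sa, sb, sc, ra, rb, rc, tr, f0, f1, f2⟩ := hc
  have t00 : R (a 0) (b 0) (c 0) = true := tr 0 0
  have t01 : R (a 0) (b 1) (c 2) = true := tr 0 1
  have t02 : R (a 0) (b 2) (c 1) = true := tr 0 2
  have t10 : R (a 1) (b 0) (c 2) = true := tr 1 0
  have t11 : R (a 1) (b 1) (c 1) = true := tr 1 1
  have t12 : R (a 1) (b 2) (c 0) = true := tr 1 2
  have t20 : R (a 2) (b 0) (c 1) = true := tr 2 0
  have t21 : R (a 2) (b 1) (c 0) = true := tr 2 1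
  have t22 : R (a 2) (b 2) (c 2) = true := tr 2 2
  rw [Weights.eval, Weights.eval, tri_eq]
  generalize a 0 = a0 at *
  generalize a 1 = a1 at *
  generalize a 2 = a2 at *
  generalize b 0 = b0 at *
  generalize b 1 = b1 at *
  generalize b 2 = b2 at *
  generalize c 0 = c0 at *
  generalize c 1 = c1 at *
  generalize c 2 = c2 at *
  have n1 : a1 < cond nrm (Nat.succ a0) (Nat.succ x) := by
    cases nrm <;> simp <;> [lia; (have := hn rfl; lia)]
  have n2 : b1 < cond nrm (Nat.succ b0) (Nat.succ y) := by
    cases nrm <;> simp <;> [lia; (have := hn rfl; lia)]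
  have n3 : (!nrm || Nat.ble a2 a0) = true := by
    cases nrm <;> simp; exact (hn rfl).2.1
  have n4 : (!nrm || Nat.ble b2 b0) = true := by
    cases nrm <;> simp; exact (hn rfl).2.2.2
  have ea : Nat.sub (Nat.sub x a0) a1 = a2 := by simp only [Nat.sub_eq]; lia
  have eb : Nat.sub (Nat.sub y b0) b1 = b2 := by simp only [Nat.sub_eq]; lia
  have ec : Nat.sub (Nat.sub z c0) c1 = c2 := by simp only [Nat.sub_eq]; lia
  have ea' : Nat.beq (Nat.add a0 (Nat.add a1 a2)) x = true := by
    simp only [Nat.add_eq, Nat.beq_eq]; lia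
  have eb' : Nat.beq (Nat.add b0 (Nat.add b1 b2)) y = true := by
    simp only [Nat.add_eq, Nat.beq_eq]; lia
  have ec' : Nat.beq (c0 + c1 + c2) z = true := by
    rw [Nat.beq_eq]; exact sc
  simp only [check, force_eq] at h
  have h1 := allB_iff.1 h a0 (by simp only [Nat.succ_eq_add_one]; lia)
  have h2 := allB_iff.1 h1 a1 n1
  rw [ea, n3, ea', ra] at h2
  simp only [Bool.and_true, Bool.not_true, Bool.false_or] at h2
  have h3 := allB_iff.1 h2 b0 (by simp only [Nat.succ_eq_add_one]; lia)
  have h4 := allB_iff.1 h3 b1 n2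
  rw [eb, n4, eb', rb] at h4
  simp only [Bool.and_true, Bool.not_true, Bool.false_or] at h4
  have h5 := allB_iff.1 h4 c0 (by
    have := hT _ _ _ t00
    have := hT _ _ _ t12
    have := hT _ _ _ t21
    simp only [Nat.succ_eq_add_one, Nat.sub_eq, Nat.add_eq]
    have hm : mx (a0 + b0) (mx (a1 + b2) (a2 + b1)) ≤ T - c0 := by
      simp only [mx_le]; lia
    lia)
  set m2 := Nat.sub T (mx (Nat.add a0 b1) (mx (Nat.add a1 b0) (Nat.add a2 b2))) with hm2
  have g2 : c2 ≤ m2 := by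
    have := hT _ _ _ t01
    have := hT _ _ _ t10
    have := hT _ _ _ t22
    rw [hm2]
    simp only [Nat.sub_eq, Nat.add_eq]
    have hm : mx (a0 + b1) (mx (a1 + b0) (a2 + b2)) ≤ T - c2 := by
      simp only [mx_le]; lia
    lia
  set l := Nat.sub (Nat.sub z c0) m2 with hl
  have gl : l ≤ c1 := by simp only [hl, Nat.sub_eq]; lia
  have h6 := allB_iff.1 h5 (c1 - l) (by
    have := hT _ _ _ t02
    have := hT _ _ _ t11
    have := hT _ _ _ t20
    simp only [Nat.succ_eq_add_one, Nat.sub_eq, Nat.add_eq]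
    have hm : mx (a0 + b2) (mx (a1 + b1) (a2 + b0)) ≤ T - c1 := by
      simp only [mx_le]; lia
    lia)
  have el : Nat.add l (c1 - l) = c1 := by simp only [Nat.add_eq]; lia
  simp only [el, ec, ec', rc, t00, t01, t02, t10, t11, t12, t20, t21, t22, Bool.and_true,
    Nat.add_eq, Nat.mul_eq, ← add_assoc, f0, f1, f2, Bool.not_true, Bool.or_false,
    Nat.ble_eq] at h6
  exact h6

theorem tri_shift (a b c : ZMod 3 → ℕ) (s t : ZMod 3) :
    tri (fun i => a (i + s)) (fun i => b (i + t)) (fun i => c (i - s - t)) = tri a b c := by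
  unfold tri
  rw [← Equiv.sum_comp (Equiv.addRight s) fun i => ∑ j, a i * (b j * c (-i - j))]
  refine sum_congr rfl fun i _ => ?_
  rw [← Equiv.sum_comp (Equiv.addRight t) fun j =>
    a (Equiv.addRight s i) * (b j * c (-Equiv.addRight s i - j))]
  refine sum_congr rfl fun j _ => ?_
  simp only [Equiv.coe_addRight]
  rw [show -(i + s) - (j + t) = -i - j - s - t by ring]

def CyclicInv {α : Type} (R : ℕ → ℕ → ℕ → α) : Prop := ∀ a b c, R a b c = R b c a

theorem CyclicInv.shift {α : Type} {R : ℕ → ℕ → ℕ → α} (h : CyclicInv R) (a : ZMod 3 → ℕ)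
    (s : ZMod 3) : R (a (0 + s)) (a (1 + s)) (a (2 + s)) = R (a 0) (a 1) (a 2) := by
  rcases zmod3_cases s with rfl | rfl | rfl
  · rfl
  · exact (h _ _ _).symm
  · exact h _ _ _

theorem cyclicInv_sum : CyclicInv fun a b c : ℕ => a + b + c := fun a b c => by ring
theorem cyclicInv_sq : CyclicInv sq := fun a b c => by
  simp only [sq, Nat.add_eq, Nat.mul_eq]; ring
theorem cyclicInv_cu : CyclicInv cu := fun a b c => by
  simp only [cu, Nat.add_eq, Nat.mul_eq]; ring

theorem eval_shift (w : Weights) (a b c : ZMod 3 → ℕ) (s t : ZMod 3) :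
    w.eval (fun i => a (i + s)) (fun i => b (i + t)) (fun i => c (i - s - t)) = w.eval a b c := by
  have e (i : ZMod 3) : i - s - t = i + (-s - t) := by ring
  rw [Weights.eval, tri_shift]
  simp only [e, cyclicInv_sq.shift, cyclicInv_cu.shift]
  rfl

theorem exists_max (a : ZMod 3 → ℕ) : ∃ s, a (1 + s) ≤ a (0 + s) ∧ a (2 + s) ≤ a (0 + s) := by
  obtain ⟨s, hs⟩ := Finite.exists_max a
  exact ⟨s, by simpa using hs _, by simpa using hs _⟩

def anyTriple : TripleTest := fun _ _ _ => true

theorem le_of_check {nrm : Bool} {x y z T : ℕ} {R F₀ F₁ : TripleTest} {p q : Weights}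
    (hR : CyclicInv R) (hF : nrm = true → F₀ = anyTriple ∧ F₁ = anyTriple)
    (hT : ∀ u v w, R u v w = true → u + v + w ≤ T)
    (h : check nrm x y z T R F₀ F₁ p q = true) {a b c : ZMod 3 → ℕ}
    (hc : Admissible x y z R F₀ F₁ a b c) :
    q.eval a b c ≤ p.eval a b c := by
  cases nrm
  · exact le_of_check_aux hT h hc (by simp)
  obtain ⟨s, hs⟩ := exists_max a
  obtain ⟨t, ht⟩ := exists_max b
  obtain ⟨rfl, rfl⟩ := hF rfl
  rw [← eval_shift q a b c s t, ← eval_shift p a b c s t]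
  have e (i : ZMod 3) : i - s - t = i + (-s - t) := by ring
  refine le_of_check_aux hT h ⟨?_, ?_, ?_, ?_, ?_, ?_, fun i j => ?_, rfl, rfl, rfl⟩
    fun _ => ⟨hs.1, hs.2, ht.1, ht.2⟩
  · exact (cyclicInv_sum.shift a s).trans hc.suma
  · exact (cyclicInv_sum.shift b t).trans hc.sumb
  · simp only [e]
    exact (cyclicInv_sum.shift c _).trans hc.sumc
  · exact (hR.shift a s).trans hc.rowa
  · exact (hR.shift b t).trans hc.rowb
  · simp only [e]
    exact (hR.shift c _).trans hc.rowc
  · have := hc.trans (i + s) (j + t)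
    rw [show -(i + s) - (j + t) = -i - j - s - t by ring] at this
    exact this

section Transfer
variable {V : Type} [AddCommGroup V] [Module (ZMod 3) V] [Fintype V] [DecidableEq V]

noncomputable instance (χ : Module.Dual (ZMod 3) V) : Fintype (LinearMap.ker χ) :=
  Fintype.ofFinite _

theorem card_ker {n : ℕ} (hV : Fintype.card V = 3 ^ (n + 1)) {χ : Module.Dual (ZMod 3) V}
    (hχ : χ ≠ 0) : Fintype.card (LinearMap.ker χ) = 3 ^ n := by
  rw [← card_level (hV.trans (pow_succ' 3 n)) hχ 0]
  exact Fintype.card_of_subtype _ fun x => by simp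

theorem CapSet.add_left {S : Finset V} (hS : CapSet S) (v : V) :
    CapSet ({x | v + x ∈ S} : Finset V) := by
  intro a ha b hb c hc h
  simp only [mem_filter, mem_univ, true_and] at ha hb hc
  have := hS _ ha _ hb _ hc (by
    rw [show v + a + (v + b) + (v + c) = (v + v + v) + (a + b + c) by abel, h,
      add_self_add_self, add_zero])
  simpa using this

theorem cnt_add_left (S : Finset V) (v : V) (u : Module.Dual (ZMod 3) V) (m : ZMod 3) :
    cnt ({x | v + x ∈ S} : Finset V) u m = cnt S u (m + u v) := by
  refine card_bij (fun x _ => v + x) ?_ (by simp) ?_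
  · simp only [mem_filter, mem_univ, true_and]
    rintro x ⟨h, rfl⟩
    exact ⟨h, by rw [map_add, add_comm]⟩
  · simp only [mem_filter, mem_univ, true_and]
    rintro x ⟨h, hx⟩
    exact ⟨x - v, ⟨by simpa using h, by simp [hx]⟩, by abel⟩

/-- The points of the kernel of `χ` whose translate by `v` lies in `S`. -/
noncomputable def kerSlice (S : Finset V) (χ : Module.Dual (ZMod 3) V) (v : V) :
    Finset (LinearMap.ker χ) :=
  {w | v + (w : V) ∈ S}

theorem CapSet.kerSlice {S : Finset V} (hS : CapSet S) (χ : Module.Dual (ZMod 3) V) (v : V) :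
    CapSet (kerSlice S χ v) := by
  intro a ha b hb c hc h
  rw [CapSlice.kerSlice, mem_filter_univ] at ha hb hc
  have := hS.add_left v a (by simpa using ha) b (by simpa using hb) c (by simpa using hc)
    (congrArg Subtype.val h)
  exact ⟨Subtype.ext this.1, Subtype.ext this.2⟩

theorem card_kerSlice (S : Finset V) (χ : Module.Dual (ZMod 3) V) (v : V) :
    #(kerSlice S χ v) = cnt S χ (χ v) := by
  refine card_bij (fun x _ => v + (x : V)) ?_ (by simp) ?_
  · rintro ⟨x, hx⟩
    rw [LinearMap.mem_ker] at hx
    simp [kerSlice, hx]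
  · simp only [mem_filter]
    rintro x ⟨h, hx⟩
    exact ⟨⟨x - v, by simp [hx]⟩, by simpa [kerSlice] using h, by simp⟩

theorem cnt_kerSlice (S : Finset V) (χ u : Module.Dual (ZMod 3) V) {v : V} (hv : u v = 0)
    (m : ZMod 3) :
    cnt (kerSlice S χ v) (u.domRestrict (LinearMap.ker χ)) m = cnt (row S χ (χ v)) u m := by
  refine card_bij (fun x _ => v + (x : V)) ?_ (by simp) ?_
  · rintro ⟨x, hx⟩
    rw [LinearMap.mem_ker] at hx
    rw [mem_filter, mem_filter, kerSlice, mem_filter_univ, mem_row]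
    simp +contextual [hx, hv]
  · simp only [mem_filter, mem_row]
    rintro x ⟨⟨h, hx⟩, hu⟩
    exact ⟨⟨x - v, by simp [hx]⟩, ⟨by simpa [kerSlice] using h, by simp [hv, hu]⟩, by simp⟩

end Transfer

/-- Every cap in dimension `n` has slices passing the test `R` in every direction. -/
def SliceProp (n : ℕ) (R : TripleTest) : Prop :=
  ∀ (V : Type) [AddCommGroup V] [Module (ZMod 3) V] [Fintype V] [DecidableEq V],
    Fintype.card V = 3 ^ n → ∀ S : Finset V, CapSet S → ∀ u : Module.Dual (ZMod 3) V, u ≠ 0 →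
      R (cnt S u 0) (cnt S u 1) (cnt S u 2) = true

/-- Every cap in dimension `n` has at most `B` points. -/
def CapBound (n B : ℕ) : Prop :=
  ∀ (V : Type) [AddCommGroup V] [Module (ZMod 3) V] [Fintype V] [DecidableEq V],
    Fintype.card V = 3 ^ n → ∀ S : Finset V, CapSet S → #S ≤ B

section Main
variable {V : Type} [AddCommGroup V] [Module (ZMod 3) V] [Fintype V] [DecidableEq V]

theorem CapBound.cnt_le {n B : ℕ} (h : CapBound n B) (hV : Fintype.card V = 3 ^ (n + 1))
    {S : Finset V} (hS : CapSet S) {χ : Module.Dual (ZMod 3) V} (hχ : χ ≠ 0) (i : ZMod 3) :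
    cnt S χ i ≤ B := by
  obtain ⟨w, hw⟩ := exists_eq_one hχ
  have := h _ (card_ker hV hχ) _ (hS.kerSlice χ (i • w))
  rwa [card_kerSlice, map_smul, hw, smul_eq_mul, mul_one] at this

theorem SliceProp.row {n : ℕ} {R : TripleTest} (h : SliceProp n R)
    (hV : Fintype.card V = 3 ^ (n + 1)) {S : Finset V} (hS : CapSet S)
    {χ u : Module.Dual (ZMod 3) V} (hu : Indep χ u) (i : ZMod 3) :
    R (cnt (row S χ i) u 0) (cnt (row S χ i) u 1) (cnt (row S χ i) u 2) = true := by
  obtain ⟨v, rfl, hv⟩ := hu i 0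
  have := h _ (card_ker hV hu.ne_zero_left) _ (hS.kerSlice χ v)
    (u.domRestrict (LinearMap.ker χ)) (by
      intro h0
      obtain ⟨x, hx, hux⟩ := hu 0 1
      have := congrArg (fun f => f ⟨x, hx⟩) h0
      simp [hux] at this)
  simpa only [cnt_kerSlice S χ u hv] using this

theorem cnt_row (S : Finset V) (χ u : Module.Dual (ZMod 3) V) (i m : ZMod 3) :
    cnt (row S χ i) u m = #{x ∈ S | χ x = i ∧ u x = m} := by
  rw [cnt, row, filter_filter]

theorem cnt_row_sub (S : Finset V) (χ u : Module.Dual (ZMod 3) V) (r i t : ZMod 3) :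
    cnt (row S (u + r • χ) i) χ t = cnt (row S χ t) u (i - r * t) := by
  rw [cnt_row, cnt_row]
  congr 1
  ext x
  simp only [mem_filter, LinearMap.add_apply, LinearMap.smul_apply, smul_eq_mul,
    and_congr_right_iff]
  rintro -
  constructor
  · rintro ⟨rfl, rfl⟩
    exact ⟨rfl, by ring⟩
  · rintro ⟨rfl, h⟩
    exact ⟨by rw [h]; ring, rfl⟩

theorem cnt_eq_diag (S : Finset V) (χ u : Module.Dual (ZMod 3) V) (r m : ZMod 3) :
    cnt S (u + r • χ) m =
      cnt (row S χ 0) u m + cnt (row S χ 1) u (m - r) + cnt (row S χ 2) u (m - 2 * r) := by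
  have := cnt_sum (row S (u + r • χ) m) χ
  rw [cnt_row_sub, cnt_row_sub, cnt_row_sub, card_row, mul_zero, mul_one, sub_zero,
    mul_comm r 2] at this
  exact this.symm

theorem admissible {n : ℕ} {R F₀ F₁ : TripleTest} (h : SliceProp n R)
    (hV : Fintype.card V = 3 ^ (n + 1)) {S : Finset V} (hS : CapSet S)
    {χ u : Module.Dual (ZMod 3) V} (hu : Indep χ u)
    (h0 : F₀ (cnt S u 0) (cnt S u 1) (cnt S u 2) = true)
    (h1 : ∀ ψ ≠ 0, F₁ (cnt S ψ 0) (cnt S ψ 1) (cnt S ψ 2) = true) :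
    Admissible (cnt S χ 0) (cnt S χ 1) (cnt S χ 2) R F₀ F₁
      (cnt (row S χ 0) u) (cnt (row S χ 1) u) (cnt (row S χ 2) u) := by
  refine ⟨cnt_sum _ _, cnt_sum _ _, cnt_sum _ _, h.row hV hS hu _, h.row hV hS hu _,
    h.row hV hS hu _, fun i j => ?_, ?_, ?_, ?_⟩
  · have := h.row hV hS (hu.add_smul (i - j)).symm i
    rw [cnt_row_sub, cnt_row_sub, cnt_row_sub] at this
    convert this using 2 <;> congr 1
    · ring
    · ring
    · have h3 : (3 : ZMod 3) = 0 := rfl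
      linear_combination -j * h3
  · have e (m) := cnt_eq_diag S χ u 0 m
    simp only [zero_smul, add_zero, mul_zero, sub_zero] at e
    simpa only [e] using h0
  · have := h1 _ (hu.add_smul 2).ne.1
    simp only [cnt_eq_diag S χ u] at this
    exact this
  · have := h1 _ (hu.add_smul 1).ne.1
    simp only [cnt_eq_diag S χ u] at this
    exact this

/-- A certificate bounds the moments of all slice matrices of `S` along `χ`. -/
theorem certificate {n : ℕ} {R F₀ F₁ : TripleTest} (h : SliceProp n R) (hR : CyclicInv R)
    (hV : Fintype.card V = 3 ^ (n + 1)) {S : Finset V} (hS : CapSet S)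
    {χ : Module.Dual (ZMod 3) V} {nrm : Bool} {x y z T : ℕ} {p q : Weights}
    (hx : cnt S χ 0 = x) (hy : cnt S χ 1 = y) (hz : cnt S χ 2 = z)
    (hF : nrm = true → F₀ = anyTriple ∧ F₁ = anyTriple)
    (hT : ∀ u v w, R u v w = true → u + v + w ≤ T)
    (hc : check nrm x y z T R F₀ F₁ p q = true)
    {u : Module.Dual (ZMod 3) V} (hu : Indep χ u)
    (h0 : F₀ (cnt S u 0) (cnt S u 1) (cnt S u 2) = true)
    (h1 : ∀ ψ ≠ 0, F₁ (cnt S ψ 0) (cnt S ψ 1) (cnt S ψ 2) = true) :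
    q.eval (cnt (row S χ 0) u) (cnt (row S χ 1) u) (cnt (row S χ 2) u) ≤
      p.eval (cnt (row S χ 0) u) (cnt (row S χ 1) u) (cnt (row S χ 2) u) := by
  subst hx hy hz
  exact le_of_check hR hF hT hc (admissible h hV hS hu h0 h1)

theorem not_slices {n : ℕ} {R F : TripleTest} (h : SliceProp n R) (hR : CyclicInv R)
    (hV : Fintype.card V = 3 ^ (n + 1)) {S : Finset V} (hS : CapSet S)
    {χ : Module.Dual (ZMod 3) V} (hχ : χ ≠ 0) {nrm : Bool} {x y z T : ℕ} (p q : Weights)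
    (hF : nrm = true → F = anyTriple)
    (hT : ∀ u v w, R u v w = true → u + v + w ≤ T)
    (hc : check nrm x y z T R F F p q = true)
    (hlt : p.total (3 ^ n) x y z + 3 * q.const x y z < q.total (3 ^ n) x y z + 3 * p.const x y z)
    (h1 : ∀ ψ ≠ 0, F (cnt S ψ 0) (cnt S ψ 1) (cnt S ψ 2) = true) :
    ¬ (cnt S χ 0 = x ∧ cnt S χ 1 = y ∧ cnt S χ 2 = z) := by
  rintro ⟨hx, hy, hz⟩
  have := (duality (hV.trans (pow_succ' 3 n)) hS hχ p q fun u hu =>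
    certificate h hR hV hS hx hy hz (fun e => ⟨hF e, hF e⟩) hT hc hu (h1 u hu.ne.1) h1).1
  rw [hx, hy, hz] at this
  lia

/-- `a`, `b`, `c` bound `x`, `y`, `z` from above. -/
def ge3 (x y z : ℕ) : TripleTest := fun a b c => Nat.ble x a && Nat.ble y b && Nat.ble z c

/-- No permutation of `a`, `b`, `c` bounds `x`, `y`, `z` from above. -/
def notGe (x y z : ℕ) : TripleTest := fun a b c =>
  !(ge3 x y z a b c || ge3 x y z b c a || ge3 x y z c a b ||
    ge3 x y z a c b || ge3 x y z c b a || ge3 x y z b a c)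

theorem cyclicInv_notGe (x y z : ℕ) : CyclicInv (notGe x y z) := fun a b c => by
  unfold notGe
  cases ge3 x y z a b c <;> cases ge3 x y z b c a <;> cases ge3 x y z c a b <;>
    cases ge3 x y z a c b <;> cases ge3 x y z c b a <;> cases ge3 x y z b a c <;> rfl

theorem CyclicInv.and {R R' : TripleTest} (h : CyclicInv R) (h' : CyclicInv R') :
    CyclicInv fun a b c => R a b c && R' a b c := fun a b c => by
  simp only [h a b c, h' a b c]

theorem cnt_neg (S : Finset V) (u : Module.Dual (ZMod 3) V) (m : ZMod 3) :
    cnt S (-u) m = cnt S u (-m) := by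
  simp only [cnt, LinearMap.neg_apply, neg_eq_iff_eq_neg]

/-- If the counts of `S` dominate a permutation of `x`, `y`, `z`, then some cap realizes
these numbers exactly. -/
theorem exists_cap_of_not_notGe {S : Finset V} (hS : CapSet S) {u : Module.Dual (ZMod 3) V}
    (hu : u ≠ 0) {x y z : ℕ} (h : notGe x y z (cnt S u 0) (cnt S u 1) (cnt S u 2) ≠ true) :
    ∃ S' : Finset V, ∃ u', CapSet S' ∧ u' ≠ 0 ∧ #S' = x + y + z ∧
      cnt S' u' 0 = x ∧ cnt S' u' 1 = y ∧ cnt S' u' 2 = z ∧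
      ∃ v, ∀ ψ m, cnt S' ψ m ≤ cnt S ψ (m + ψ v) := by
  obtain ⟨u', v, hu', hx, hy, hz⟩ : ∃ u' v, u' ≠ 0 ∧ x ≤ cnt S u' (0 + u' v) ∧
      y ≤ cnt S u' (1 + u' v) ∧ z ≤ cnt S u' (2 + u' v) := by
    obtain ⟨w, hw⟩ := exists_eq_one hu
    simp only [notGe, ge3, ne_eq, Bool.not_eq_true', Bool.not_eq_false, Bool.or_eq_true,
      Bool.and_eq_true, Nat.ble_eq] at h
    rcases h with ((((h | h) | h) | h) | h) | h
    · exact ⟨u, 0, hu, by simpa using h.1.1, by simpa using h.1.2, by simpa using h.2⟩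
    · exact ⟨u, w, hu, by rw [hw]; exact h.1.1, by rw [hw]; exact h.1.2, by rw [hw]; exact h.2⟩
    · exact ⟨u, -w, hu, by rw [map_neg, hw]; exact h.1.1, by rw [map_neg, hw]; exact h.1.2,
        by rw [map_neg, hw]; exact h.2⟩
    · refine ⟨-u, 0, neg_ne_zero.2 hu, ?_, ?_, ?_⟩ <;> rw [cnt_neg, map_zero]
      exacts [h.1.1, h.1.2, h.2]
    · refine ⟨-u, -w, neg_ne_zero.2 hu, ?_, ?_, ?_⟩ <;>
        rw [cnt_neg, LinearMap.neg_apply, map_neg, hw]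
      exacts [h.1.1, h.1.2, h.2]
    · refine ⟨-u, w, neg_ne_zero.2 hu, ?_, ?_, ?_⟩ <;> rw [cnt_neg, LinearMap.neg_apply, hw]
      exacts [h.1.1, h.1.2, h.2]
  rw [← cnt_add_left] at hx hy hz
  obtain ⟨X, hX, rfl⟩ := exists_subset_card_eq hx
  obtain ⟨Y, hY, rfl⟩ := exists_subset_card_eq hy
  obtain ⟨Z, hZ, rfl⟩ := exists_subset_card_eq hz
  set S₁ : Finset V := {x | v + x ∈ S} with hS₁
  have hX' (a) (ha : a ∈ X) : a ∈ S₁ ∧ u' a = 0 := by simpa using hX ha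
  have hY' (a) (ha : a ∈ Y) : a ∈ S₁ ∧ u' a = 1 := by simpa using hY ha
  have hZ' (a) (ha : a ∈ Z) : a ∈ S₁ ∧ u' a = 2 := by simpa using hZ ha
  have e1 : (0 : ZMod 3) ≠ 1 := by decide
  have e2 : (0 : ZMod 3) ≠ 2 := by decide
  have e3 : (1 : ZMod 3) ≠ 2 := by decide
  have hsub : X ∪ Y ∪ Z ⊆ S₁ := by
    intro a
    simp only [mem_union]
    rintro ((h | h) | h)
    exacts [(hX' a h).1, (hY' a h).1, (hZ' a h).1]
  have c0 : cnt (X ∪ Y ∪ Z) u' 0 = #X := by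
    rw [cnt]; congr 1; ext a
    simp only [mem_filter, mem_union]
    grind
  have c1 : cnt (X ∪ Y ∪ Z) u' 1 = #Y := by
    rw [cnt]; congr 1; ext a
    simp only [mem_filter, mem_union]
    grind
  have c2 : cnt (X ∪ Y ∪ Z) u' 2 = #Z := by
    rw [cnt]; congr 1; ext a
    simp only [mem_filter, mem_union]
    grind
  refine ⟨X ∪ Y ∪ Z, u', (hS.add_left v).mono hsub, hu', ?_, c0, c1, c2, v, fun ψ m => ?_⟩
  · rw [← cnt_sum _ u', c0, c1, c2]
  · rw [← cnt_add_left]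
    exact card_le_card (filter_subset_filter _ hsub)

end Main

theorem sliceProp_notGe {n x y z : ℕ}
    (h : ∀ (V : Type) [AddCommGroup V] [Module (ZMod 3) V] [Fintype V] [DecidableEq V],
      Fintype.card V = 3 ^ n → ∀ S : Finset V, CapSet S → ∀ u : Module.Dual (ZMod 3) V, u ≠ 0 →
        ¬ (cnt S u 0 = x ∧ cnt S u 1 = y ∧ cnt S u 2 = z)) :
    SliceProp n (notGe x y z) := by
  intro V _ _ _ _ hV S hS u hu
  by_contra hc
  obtain ⟨S', u', hS', hu', -, h0, h1, h2, -⟩ := exists_cap_of_not_notGe hS hu hc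
  exact h V hV S' hS' u' hu' ⟨h0, h1, h2⟩

theorem SliceProp.and {n : ℕ} {R R' : TripleTest} (h : SliceProp n R) (h' : SliceProp n R') :
    SliceProp n fun a b c => R a b c && R' a b c := by
  intro V _ _ _ _ hV S hS u hu
  rw [Bool.and_eq_true]
  exact ⟨h V hV S hS u hu, h' V hV S hS u hu⟩

theorem sliceProp_of_check {n x y z T : ℕ} {R F : TripleTest} {nrm : Bool}
    (h : SliceProp n R) (hR : CyclicInv R) (hF : SliceProp (n + 1) F) (p q : Weights)
    (hn : nrm = true → F = anyTriple)
    (hT : ∀ u v w, R u v w = true → u + v + w ≤ T)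
    (hc : check nrm x y z T R F F p q = true)
    (hlt : p.total (3 ^ n) x y z + 3 * q.const x y z < q.total (3 ^ n) x y z + 3 * p.const x y z) :
    SliceProp (n + 1) (notGe x y z) := by
  refine sliceProp_notGe ?_
  intro V _ _ _ _ hV S hS u hu
  exact not_slices h hR hV hS hu p q hn hT hc hlt (hF V hV S hS)

/-! ### Caps of dimension at most five -/

def rows (B : ℕ) : TripleTest := fun a b c => Nat.ble a B && Nat.ble b B && Nat.ble c B

def sumLe (T : ℕ) : TripleTest := fun a b c => Nat.ble (Nat.add a (Nat.add b c)) T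

theorem cyclicInv_rows (B : ℕ) : CyclicInv (rows B) := fun a b c => by
  rw [rows, rows, Bool.and_right_comm, Bool.and_assoc, Bool.and_comm]
  cases Nat.ble a B <;> cases Nat.ble b B <;> cases Nat.ble c B <;> rfl

theorem cyclicInv_sumLe (T : ℕ) : CyclicInv (sumLe T) := fun a b c => by
  unfold sumLe
  congr 1
  simp only [Nat.add_eq]
  ring

theorem sumLe_le {T u v w : ℕ} (h : sumLe T u v w = true) : u + v + w ≤ T := by
  rw [sumLe, Nat.ble_eq] at h
  simp only [Nat.add_eq] at h
  lia

theorem CapBound.rows {n B : ℕ} (h : CapBound n B) : SliceProp (n + 1) (rows B) := by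
  intro V _ _ _ _ hV S hS u hu
  simp [CapSlice.rows, h.cnt_le hV hS hu]

theorem CapBound.sumLe {n T : ℕ} (h : CapBound n T) : SliceProp n (sumLe T) := by
  intro V _ _ _ _ hV S hS u hu
  have := h V hV S hS
  rw [← cnt_sum S u] at this
  simp only [CapSlice.sumLe, Nat.add_eq, Nat.ble_eq]
  lia

theorem sliceProp_anyTriple (n : ℕ) : SliceProp n anyTriple := by
  intro V _ _ _ _ hV S hS u hu
  rfl

/-- Certifies an inequality between the moments of the slices of a cap with `X` points. -/
def checkOne (X : ℕ) (R : TripleTest) (p0 p1 p2 q0 q1 q2 : ℕ) : Bool :=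
  allB (Nat.succ X) fun a => allB (Nat.succ X) fun b => force (Nat.sub (Nat.sub X a) b) fun c =>
    Nat.ble (Nat.add q0 (Nat.add (Nat.mul q1 (sq a b c)) (Nat.mul q2 (cu a b c))))
      (Nat.add p0 (Nat.add (Nat.mul p1 (sq a b c)) (Nat.mul p2 (cu a b c)))) ||
    !(Nat.beq (Nat.add a (Nat.add b c)) X && R a b c)

theorem le_of_checkOne {X : ℕ} {R : TripleTest} {p0 p1 p2 q0 q1 q2 : ℕ}
    (h : checkOne X R p0 p1 p2 q0 q1 q2 = true) {a b c : ℕ} (hX : a + b + c = X)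
    (hR : R a b c = true) :
    q0 + q1 * sq a b c + q2 * cu a b c ≤ p0 + p1 * sq a b c + p2 * cu a b c := by
  have h1 := allB_iff.1 (allB_iff.1 h a (by simp only [Nat.succ_eq_add_one]; lia)) b
    (by simp only [Nat.succ_eq_add_one]; lia)
  have ec : Nat.sub (Nat.sub X a) b = c := by simp only [Nat.sub_eq]; lia
  have es : Nat.beq (a + b + c) X = true := by rw [Nat.beq_eq]; exact hX
  simp only [force_eq, ec, Nat.add_eq, Nat.mul_eq, ← add_assoc, es, hR, Bool.and_true,
    Bool.not_true, Bool.or_false, Nat.ble_eq] at h1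
  exact h1

theorem capBound_of_checkOne {n X : ℕ} {R : TripleTest} (h : SliceProp (n + 1) R)
    (p0 p1 p2 q0 q1 q2 : ℕ) (hc : checkOne (X + 1) R p0 p1 p2 q0 q1 q2 = true)
    (hlt : 3 ^ n * (3 * p0 + p1 * ((X + 1) * (X + 1) + 2 * (X + 1)) +
        p2 * ((X + 1) * (X + 1) * (X + 1) + 2 * (X + 1))) +
        (q0 + q1 * ((X + 1) * (X + 1)) + q2 * ((X + 1) * (X + 1) * (X + 1))) <
      3 ^ n * (3 * q0 + q1 * ((X + 1) * (X + 1) + 2 * (X + 1)) +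
        q2 * ((X + 1) * (X + 1) * (X + 1) + 2 * (X + 1))) +
        (p0 + p1 * ((X + 1) * (X + 1)) + p2 * ((X + 1) * (X + 1) * (X + 1)))) :
    CapBound (n + 1) X := by
  intro V _ _ _ _ hV S hS
  by_contra! hlt'
  obtain ⟨S', hsub, hS'⟩ := exists_subset_card_eq (Nat.succ_le_of_lt hlt')
  have hcap := hS.mono hsub
  have := (duality_one (hV.trans (pow_succ' 3 n)) hcap p0 p1 p2 q0 q1 q2 fun u hu =>
    le_of_checkOne hc ((cnt_sum S' u).trans hS') (h V hV S' hcap u hu)).1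
  rw [hS', Nat.succ_eq_add_one] at this
  lia

theorem capBound_zero : CapBound 0 1 := by
  intro V _ _ _ _ hV S hS
  exact (card_le_univ S).trans hV.le

theorem capBound_one : CapBound 1 2 :=
  capBound_of_checkOne (capBound_zero.rows) 0 0 3 27 0 0
    (by decide +kernel) (by norm_num)

theorem capBound_two : CapBound 2 4 :=
  capBound_of_checkOne (capBound_one.rows) 0 12 3 226 0 0
    (by decide +kernel) (by norm_num)

theorem capBound_three : CapBound 3 9 :=
  capBound_of_checkOne (capBound_two.rows) 0 219 51 24301 0 0
    (by decide +kernel) (by norm_num)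

def slices₂ : TripleTest := fun a b c => rows 2 a b c && sumLe 4 a b c

theorem sliceProp_two : SliceProp 2 slices₂ := capBound_one.rows.and capBound_two.sumLe

theorem cyclicInv_slices₂ : CyclicInv slices₂ := (cyclicInv_rows _).and (cyclicInv_sumLe _)

theorem slices₂_le (u v w : ℕ) (h : slices₂ u v w = true) : u + v + w ≤ 4 :=
  sumLe_le (Bool.and_eq_true_iff.1 h).2

theorem sliceProp_4_3_2 : SliceProp 3 (notGe 4 3 2) :=
  sliceProp_of_check (nrm := true) (T := 4) (F := anyTriple) sliceProp_two cyclicInv_slices₂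
    (sliceProp_anyTriple _)
    ⟨56, 0, 0, 0, 0, 0, 0, 0⟩ ⟨0, 2, 1, 1, 0, 4, 1, 1⟩
    (fun _ => rfl) slices₂_le (by decide +kernel) (by norm_num [Weights.total, Weights.const])

def slices₃ : TripleTest := fun a b c => rows 4 a b c && sumLe 9 a b c && notGe 4 3 2 a b c

theorem sliceProp_three : SliceProp 3 slices₃ :=
  (capBound_two.rows.and capBound_three.sumLe).and sliceProp_4_3_2

theorem cyclicInv_slices₃ : CyclicInv slices₃ :=
  ((cyclicInv_rows _).and (cyclicInv_sumLe _)).and (cyclicInv_notGe _ _ _)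

theorem slices₃_le (u v w : ℕ) (h : slices₃ u v w = true) : u + v + w ≤ 9 :=
  sumLe_le (Bool.and_eq_true_iff.1 (Bool.and_eq_true_iff.1 h).1).2

theorem sliceProp_9_7_3 : SliceProp 4 (notGe 9 7 3) :=
  sliceProp_of_check (nrm := true) (T := 9) (F := anyTriple) sliceProp_three cyclicInv_slices₃
    (sliceProp_anyTriple _)
    ⟨0, 0, 0, 5, 2, 0, 0, 5⟩ ⟨313, 2, 1, 0, 0, 2, 0, 0⟩
    (fun _ => rfl) slices₃_le (by decide +kernel) (by norm_num [Weights.total, Weights.const])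

theorem sliceProp_9_6_4 : SliceProp 4 (notGe 9 6 4) :=
  sliceProp_of_check (nrm := true) (T := 9) (F := anyTriple) sliceProp_three cyclicInv_slices₃
    (sliceProp_anyTriple _)
    ⟨0, 0, 0, 6, 2, 3, 0, 4⟩ ⟨522, 0, 0, 0, 0, 0, 0, 0⟩
    (fun _ => rfl) slices₃_le (by decide +kernel) (by norm_num [Weights.total, Weights.const])

theorem sliceProp_9_5_5 : SliceProp 4 (notGe 9 5 5) :=
  sliceProp_of_check (nrm := true) (T := 9) (F := anyTriple) sliceProp_three cyclicInv_slices₃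
    (sliceProp_anyTriple _)
    ⟨0, 0, 0, 1, 1, 2, 1, 3⟩ ⟨328, 0, 0, 0, 0, 0, 0, 0⟩
    (fun _ => rfl) slices₃_le (by decide +kernel) (by norm_num [Weights.total, Weights.const])

theorem sliceProp_8_8_4 : SliceProp 4 (notGe 8 8 4) :=
  sliceProp_of_check (nrm := true) (T := 9) (F := anyTriple) sliceProp_three cyclicInv_slices₃
    (sliceProp_anyTriple _)
    ⟨0, 14, 1, 25, 3, 55, 7, 33⟩ ⟨4820, 0, 0, 0, 0, 0, 0, 0⟩
    (fun _ => rfl) slices₃_le (by decide +kernel) (by norm_num [Weights.total, Weights.const])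

theorem sliceProp_8_7_5 : SliceProp 4 (notGe 8 7 5) :=
  sliceProp_of_check (nrm := true) (T := 9) (F := anyTriple) sliceProp_three cyclicInv_slices₃
    (sliceProp_anyTriple _)
    ⟨0, 15, 11, 0, 0, 0, 0, 0⟩ ⟨1845, 0, 0, 2, 1, 5, 1, 1⟩
    (fun _ => rfl) slices₃_le (by decide +kernel) (by norm_num [Weights.total, Weights.const])

theorem sliceProp_7_7_6 : SliceProp 4 (notGe 7 7 6) :=
  sliceProp_of_check (nrm := true) (T := 9) (F := anyTriple) sliceProp_three cyclicInv_slices₃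
    (sliceProp_anyTriple _)
    ⟨137, 0, 7, 0, 0, 0, 0, 0⟩ ⟨0, 27, 0, 4, 1, 2, 1, 1⟩
    (fun _ => rfl) slices₃_le (by decide +kernel) (by norm_num [Weights.total, Weights.const])

def avoidSix : TripleTest := fun a b c =>
  notGe 9 7 3 a b c && notGe 9 6 4 a b c && notGe 9 5 5 a b c && notGe 8 8 4 a b c &&
    notGe 8 7 5 a b c && notGe 7 7 6 a b c

theorem sliceProp_avoidSix : SliceProp 4 avoidSix :=
  ((((sliceProp_9_7_3.and sliceProp_9_6_4).and sliceProp_9_5_5).and sliceProp_8_8_4).and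
    sliceProp_8_7_5).and sliceProp_7_7_6

/-- A test failing on the patterns `(8, 7, 4)` and `(8, 8, 3)`. -/
def avoidTwo : TripleTest := fun a b c => notGe 8 7 4 a b c && notGe 8 8 3 a b c

section
variable {V : Type} [AddCommGroup V] [Module (ZMod 3) V] [Fintype V] [DecidableEq V]

theorem avoidTwo_of_slices (hV : Fintype.card V = 3 ^ 4) {S : Finset V} (hS : CapSet S)
    {χ : Module.Dual (ZMod 3) V} (hχ : χ ≠ 0) (h0 : cnt S χ 0 = 9) (h1 : cnt S χ 1 = 9)
    (h2 : cnt S χ 2 = 1) {ψ : Module.Dual (ZMod 3) V} (hψ : ψ ≠ 0) :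
    avoidTwo (cnt S ψ 0) (cnt S ψ 1) (cnt S ψ 2) = true := by
  rcases indep_or hχ ψ with h | rfl | rfl | rfl
  · by_contra hb
    have hd := (duality (hV.trans (pow_succ' 3 3)) hS hχ
      ⟨162, 0, 0, 0, 0, 0, 0, 12⟩ ⟨0, 0, 1, 0, 1, 0, 0, 0⟩ fun u hu =>
      certificate (F₀ := avoidSix) (F₁ := avoidSix) (nrm := false) (T := 9) sliceProp_three
        cyclicInv_slices₃ hV hS h0 h1 h2 nofun slices₃_le (by decide +kernel) hu
        (sliceProp_avoidSix V hV S hS _ hu.ne.1) (sliceProp_avoidSix V hV S hS)).2 ψ h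
    have hb' := certificate (F₀ := fun a b c => !avoidTwo a b c) (F₁ := avoidSix) (nrm := false)
      (T := 9) (p := ⟨162, 0, 0, 0, 0, 0, 0, 12⟩) (q := ⟨1, 0, 1, 0, 1, 0, 0, 0⟩)
      sliceProp_three cyclicInv_slices₃ hV hS h0 h1 h2 nofun slices₃_le (by decide +kernel) h
      (by simpa using hb) (sliceProp_avoidSix V hV S hS)
    rw [h0, h1, h2] at hd
    clear h0 h1 h2
    simp only [Weights.eval, Weights.total, Weights.const] at hd hb'
    norm_num at hd hb'
    linarith
  · exact absurd rfl hψ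
  · rw [h0, h1, h2]
    decide
  · rw [cnt_neg, cnt_neg, cnt_neg]
    change avoidTwo (cnt S χ 0) (cnt S χ 2) (cnt S χ 1) = true
    rw [h0, h1, h2]
    decide

theorem notGe_nine_nine_one (hV : Fintype.card V = 3 ^ 4) {S : Finset V} (hS : CapSet S)
    (hc : #S = 19) {χ : Module.Dual (ZMod 3) V} (hχ : χ ≠ 0)
    (h : avoidTwo (cnt S χ 0) (cnt S χ 1) (cnt S χ 2) = false)
    (ψ : Module.Dual (ZMod 3) V) (hψ : ψ ≠ 0) :
    notGe 9 9 1 (cnt S ψ 0) (cnt S ψ 1) (cnt S ψ 2) = true := by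
  by_contra hb
  obtain ⟨S', u, hS', hu, hc', h0, h1, h2, v, hv⟩ := exists_cap_of_not_notGe hS hψ hb
  have hinv : CyclicInv avoidTwo := (cyclicInv_notGe _ _ _).and (cyclicInv_notGe _ _ _)
  have e := hinv.shift (cnt S χ) (χ v)
  have s := cyclicInv_sum.shift (cnt S χ) (χ v)
  have s1 := cnt_sum S χ
  have s2 := cnt_sum S' χ
  have l0 := hv χ 0
  have l1 := hv χ 1
  have l2 := hv χ 2
  have := avoidTwo_of_slices hV hS' hu h0 h1 h2 hχ
  rw [show cnt S' χ 0 = cnt S χ (0 + χ v) by lia, show cnt S' χ 1 = cnt S χ (1 + χ v) by lia,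
    show cnt S' χ 2 = cnt S χ (2 + χ v) by lia, e, h] at this
  exact Bool.false_ne_true this

end

theorem sliceProp_8_7_4 : SliceProp 4 (notGe 8 7 4) := by
  refine sliceProp_notGe ?_
  intro V _ _ _ _ hV S hS u hu h
  refine not_slices (F := fun a b c => avoidSix a b c && notGe 9 9 1 a b c) (nrm := false) (T := 9)
    sliceProp_three cyclicInv_slices₃ hV hS hu
    ⟨0, 16, 2, 24, 3, 39, 7, 33⟩ ⟨4271, 0, 0, 0, 0, 0, 0, 0⟩ nofun slices₃_le (by decide +kernel)
    (by norm_num [Weights.total, Weights.const]) (fun ψ hψ => ?_) h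
  rw [sliceProp_avoidSix V hV S hS ψ hψ, Bool.true_and]
  refine notGe_nine_nine_one hV hS ?_ hu ?_ ψ hψ
  · rw [← cnt_sum S u, h.1, h.2.1, h.2.2]
  · rw [h.1, h.2.1, h.2.2]
    decide

theorem sliceProp_8_8_3 : SliceProp 4 (notGe 8 8 3) := by
  refine sliceProp_notGe ?_
  intro V _ _ _ _ hV S hS u hu h
  refine not_slices
    (F := fun a b c => avoidSix a b c && notGe 9 9 1 a b c && notGe 8 7 4 a b c)
    (nrm := false) (T := 9) sliceProp_three cyclicInv_slices₃ hV hS hu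
    ⟨9, 0, 0, 0, 0, 0, 0, 0⟩ ⟨0, 0, 0, 0, 0, 0, 1, 0⟩ nofun slices₃_le (by decide +kernel)
    (by norm_num [Weights.total, Weights.const]) (fun ψ hψ => ?_) h
  rw [sliceProp_avoidSix V hV S hS ψ hψ, sliceProp_8_7_4 V hV S hS ψ hψ, Bool.true_and,
    Bool.and_true]
  refine notGe_nine_nine_one hV hS ?_ hu ?_ ψ hψ
  · rw [← cnt_sum S u, h.1, h.2.1, h.2.2]
  · rw [h.1, h.2.1, h.2.2]
    decide

theorem capBound_four : CapBound 4 20 :=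
  capBound_of_checkOne (capBound_three.rows.and sliceProp_9_7_3) 0 15 3 11466 0 0
    (by decide +kernel) (by norm_num)

def slices₄ : TripleTest := fun a b c => rows 9 a b c && sumLe 20 a b c &&
  (avoidSix a b c && avoidTwo a b c)

theorem sliceProp_four : SliceProp 4 slices₄ :=
  (capBound_three.rows.and capBound_four.sumLe).and
    (sliceProp_avoidSix.and (sliceProp_8_7_4.and sliceProp_8_8_3))

theorem cyclicInv_slices₄ : CyclicInv slices₄ :=
  ((cyclicInv_rows _).and (cyclicInv_sumLe _)).and
    (CyclicInv.and ((((((cyclicInv_notGe _ _ _).and (cyclicInv_notGe _ _ _)).and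
      (cyclicInv_notGe _ _ _)).and (cyclicInv_notGe _ _ _)).and (cyclicInv_notGe _ _ _)).and (cyclicInv_notGe _ _ _))
      ((cyclicInv_notGe _ _ _).and (cyclicInv_notGe _ _ _)))

theorem slices₄_le (u v w : ℕ) (h : slices₄ u v w = true) : u + v + w ≤ 20 :=
  sumLe_le (Bool.and_eq_true_iff.1 (Bool.and_eq_true_iff.1 h).1).2

theorem sliceProp_20_20_5 : SliceProp 5 (notGe 20 20 5) :=
  sliceProp_of_check (nrm := true) (T := 20) (F := anyTriple) sliceProp_four cyclicInv_slices₄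
    (sliceProp_anyTriple _)
    ⟨0, 0, 0, 6, 0, 18, 0, 22⟩ ⟨6798, 5, 2, 0, 1, 0, 2, 0⟩
    (fun _ => rfl) slices₄_le (by decide +kernel) (by norm_num [Weights.total, Weights.const])

theorem sliceProp_20_19_6 : SliceProp 5 (notGe 20 19 6) :=
  sliceProp_of_check (nrm := true) (T := 20) (F := anyTriple) sliceProp_four cyclicInv_slices₄
    (sliceProp_anyTriple _)
    ⟨0, 0, 0, 11, 1, 8, 1, 8⟩ ⟨6920, 2, 1, 0, 0, 0, 0, 0⟩
    (fun _ => rfl) slices₄_le (by decide +kernel) (by norm_num [Weights.total, Weights.const])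

theorem sliceProp_19_19_7 : SliceProp 5 (notGe 19 19 7) :=
  sliceProp_of_check (nrm := true) (T := 20) (F := anyTriple) sliceProp_four cyclicInv_slices₄
    (sliceProp_anyTriple _)
    ⟨0, 38, 4, 59, 7, 8, 0, 22⟩ ⟨55528, 0, 0, 0, 0, 0, 0, 0⟩
    (fun _ => rfl) slices₄_le (by decide +kernel) (by norm_num [Weights.total, Weights.const])

theorem sliceProp_20_18_7 : SliceProp 5 (notGe 20 18 7) :=
  sliceProp_of_check (nrm := true) (T := 20) (F := anyTriple) sliceProp_four cyclicInv_slices₄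
    (sliceProp_anyTriple _)
    ⟨0, 0, 0, 22, 2, 11, 2, 12⟩ ⟨13941, 1, 1, 0, 0, 0, 0, 0⟩
    (fun _ => rfl) slices₄_le (by decide +kernel) (by norm_num [Weights.total, Weights.const])

def avoidFour : TripleTest := fun a b c =>
  notGe 20 20 5 a b c && notGe 20 19 6 a b c && notGe 19 19 7 a b c && notGe 20 18 7 a b c

theorem sliceProp_avoidFour : SliceProp 5 avoidFour :=
  ((sliceProp_20_20_5.and sliceProp_20_19_6).and sliceProp_19_19_7).and sliceProp_20_18_7

theorem sliceProp_19_18_8 : SliceProp 5 (notGe 19 18 8) :=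
  sliceProp_of_check (nrm := false) (T := 20) (F := avoidFour) sliceProp_four cyclicInv_slices₄
    sliceProp_avoidFour
    ⟨0, 2, 0, 114, 12, 95, 14, 51⟩ ⟨84545, 0, 1, 0, 0, 0, 0, 0⟩
    nofun slices₄_le (by decide +kernel) (by norm_num [Weights.total, Weights.const])

theorem capBound_five : CapBound 5 45 :=
  capBound_of_checkOne ((capBound_four.rows.and sliceProp_avoidFour).and sliceProp_19_18_8)
    0 5619 591 23138461 0 0
    (by decide +kernel) (by norm_num)

/-- The slice sizes of a cap with 45 points in dimension five. -/
def entries : TripleTest := fun a b c => !Nat.beq (Nat.add a (Nat.add b c)) 45 ||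
  ((Nat.beq a 9 || Nat.beq a 15 || Nat.beq a 18) && (Nat.beq b 9 || Nat.beq b 15 || Nat.beq b 18) &&
    (Nat.beq c 9 || Nat.beq c 15 || Nat.beq c 18))

theorem cyclicInv_entries : CyclicInv entries := fun a b c => by
  unfold entries
  rw [show Nat.add a (Nat.add b c) = Nat.add b (Nat.add c a) by simp only [Nat.add_eq]; ring]
  generalize (Nat.beq a 9 || Nat.beq a 15 || Nat.beq a 18) = A
  generalize (Nat.beq b 9 || Nat.beq b 15 || Nat.beq b 18) = B
  generalize (Nat.beq c 9 || Nat.beq c 15 || Nat.beq c 18) = C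
  cases A <;> cases B <;> cases C <;> rfl

theorem sliceProp_entries : SliceProp 5 entries := by
  intro V _ _ _ _ hV S hS u hu
  by_cases hc : #S = 45
  · have hP := (capBound_four.rows.and sliceProp_avoidFour).and sliceProp_19_18_8
    have h1 := (duality_one (hV.trans (pow_succ' 3 4)) hS 0 27 3 109350 0 0 fun u hu =>
      le_of_checkOne (X := 45) (R := fun a b c => rows 20 a b c && avoidFour a b c &&
      notGe 19 18 8 a b c) (by decide +kernel) ((cnt_sum S u).trans hc)
        (hP V hV S hS u hu)).2 u hu
    rw [hc] at h1
    by_contra h2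
    have h3 := le_of_checkOne (X := 45) (R := fun a b c => rows 20 a b c && avoidFour a b c &&
      notGe 19 18 8 a b c && !entries a b c) (p0 := 0) (p1 := 27) (p2 := 3) (q0 := 109351)
      (q1 := 0) (q2 := 0) (by decide +kernel) ((cnt_sum S u).trans hc)
      (Bool.and_eq_true_iff.2 ⟨hP V hV S hS u hu, by simpa using h2⟩)
    lia
  · rw [entries, Bool.or_eq_true, Bool.not_eq_true', ← Bool.not_eq_true, Nat.beq_eq]
    left
    have := cnt_sum S u
    simp only [Nat.add_eq]
    lia

def slices₅ : TripleTest := fun a b c => rows 20 a b c && sumLe 45 a b c && entries a b c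

theorem sliceProp_five : SliceProp 5 slices₅ :=
  (capBound_four.rows.and capBound_five.sumLe).and sliceProp_entries

theorem cyclicInv_slices₅ : CyclicInv slices₅ :=
  ((cyclicInv_rows _).and (cyclicInv_sumLe _)).and cyclicInv_entries

theorem slices₅_le (u v w : ℕ) (h : slices₅ u v w = true) : u + v + w ≤ 45 :=
  sumLe_le (Bool.and_eq_true_iff.1 (Bool.and_eq_true_iff.1 h).1).2

theorem sliceProp_45_43_24 : SliceProp 6 (notGe 45 43 24) :=
  sliceProp_of_check (nrm := true) (T := 45) (F := anyTriple) sliceProp_five cyclicInv_slices₅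
    (sliceProp_anyTriple _)
    ⟨0, 0, 0, 90, 5, 53, 0, 18⟩ ⟨410153, 2, 2, 0, 0, 0, 1, 0⟩
    (fun _ => rfl) slices₅_le (by decide +kernel) (by norm_num [Weights.total, Weights.const])

theorem sliceProp_45_44_23 : SliceProp 6 (notGe 45 44 23) :=
  sliceProp_of_check (nrm := true) (T := 45) (F := anyTriple) sliceProp_five cyclicInv_slices₅
    (sliceProp_anyTriple _)
    ⟨0, 0, 0, 194, 12, 0, 0, 41⟩ ⟨659807, 5, 14, 0, 0, 0, 0, 0⟩
    (fun _ => rfl) slices₅_le (by decide +kernel) (by norm_num [Weights.total, Weights.const])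

theorem sliceProp_44_44_24 : SliceProp 6 (notGe 44 44 24) :=
  sliceProp_of_check (nrm := true) (T := 45) (F := anyTriple) sliceProp_five cyclicInv_slices₅
    (sliceProp_anyTriple _)
    ⟨0, 4935, 283, 4935, 283, 1899, 41, 1113⟩ ⟨40238650, 0, 0, 0, 0, 0, 0, 0⟩
    (fun _ => rfl) slices₅_le (by decide +kernel) (by norm_num [Weights.total, Weights.const])

/-! ### Caps with 112 points in dimension six -/

section Six
variable {V : Type} [AddCommGroup V] [Module (ZMod 3) V] [Fintype V] [DecidableEq V]

/-- `u` takes the value `p` at `x` points of `S` and each other value at `y` points. -/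
def Shape (S : Finset V) (x y : ℕ) (u : Module.Dual (ZMod 3) V) (p : ZMod 3) : Prop :=
  ∀ m, cnt S u m = if m = p then x else y

theorem exists_shape (hV : Fintype.card V = 3 ^ 6) {S : Finset V} (hS : CapSet S)
    (hc : #S = 112) : ∃ u p, Shape S 22 45 u p := by
  have hrows := capBound_five.rows
  obtain ⟨u, hu, h⟩ : ∃ u ≠ 0, ¬ notGe 45 45 22 (cnt S u 0) (cnt S u 1) (cnt S u 2) = true := by
    by_contra! h
    have hP := hrows.and
      ((sliceProp_45_43_24.and sliceProp_45_44_23).and sliceProp_44_44_24)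
    have := (duality_one (hV.trans (pow_succ' 3 5)) hS 0 (3 * 11815) (3 * 617)
      (617 * 112 ^ 3 + 11815 * 112 ^ 2 + 1) 0 0 fun u hu =>
      le_of_checkOne (X := 112) (R := fun a b c => (rows 45 a b c && (notGe 45 43 24 a b c &&
        notGe 45 44 23 a b c && notGe 44 44 24 a b c)) && notGe 45 45 22 a b c)
        (by decide +kernel) ((cnt_sum S u).trans hc)
        (Bool.and_eq_true_iff.2 ⟨hP V hV S hS u hu, h u hu⟩)).1
    rw [hc] at this
    norm_num at this
  have hr := hrows V hV S hS u hu
  have hs := cnt_sum S u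
  simp only [rows, notGe, ge3, Bool.not_eq_true', Bool.not_eq_false, Bool.or_eq_true,
    Bool.and_eq_true, Nat.ble_eq] at h hr
  have key : (∃ p, Shape S 22 45 u p) := by
    have e1 : (0 : ZMod 3) ≠ 1 := by decide
    have e2 : (0 : ZMod 3) ≠ 2 := by decide
    have e3 : (1 : ZMod 3) ≠ 2 := by decide
    by_cases h0 : cnt S u 0 = 22
    · refine ⟨0, fun m => ?_⟩
      rcases zmod3_cases m with rfl | rfl | rfl <;> simp [e1.symm, e2.symm] <;> lia
    by_cases h1 : cnt S u 1 = 22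
    · refine ⟨1, fun m => ?_⟩
      rcases zmod3_cases m with rfl | rfl | rfl <;> simp [e1, e3.symm] <;> lia
    · refine ⟨2, fun m => ?_⟩
      rcases zmod3_cases m with rfl | rfl | rfl <;> simp [e2, e3] <;> lia
  exact ⟨u, key⟩

theorem slice_entries {a : ZMod 3 → ℕ} (h : slices₅ (a 0) (a 1) (a 2) = true)
    (hs : a 0 + a 1 + a 2 = 45) :
    (a 0 = 15 ∧ a 1 = 15 ∧ a 2 = 15) ∨ ∃ i, ∀ m, a m = if m = i then 9 else 18 := by
  have he := (Bool.and_eq_true_iff.1 h).2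
  have hb : Nat.beq (a 0 + (a 1 + a 2)) 45 = true := by rw [Nat.beq_eq, ← hs, add_assoc]
  simp only [entries, Nat.add_eq, hb, Bool.not_true, Bool.false_or, Bool.and_eq_true,
    Bool.or_eq_true, Nat.beq_eq] at he
  have e1 : (0 : ZMod 3) ≠ 1 := by decide
  have e2 : (0 : ZMod 3) ≠ 2 := by decide
  have e3 : (1 : ZMod 3) ≠ 2 := by decide
  by_cases h0 : a 0 = 9
  · refine .inr ⟨0, fun m => ?_⟩
    rcases zmod3_cases m with rfl | rfl | rfl <;> simp [e1.symm, e2.symm] <;> lia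
  by_cases h1 : a 1 = 9
  · refine .inr ⟨1, fun m => ?_⟩
    rcases zmod3_cases m with rfl | rfl | rfl <;> simp [e1, e3.symm] <;> lia
  by_cases h2 : a 2 = 9
  · refine .inr ⟨2, fun m => ?_⟩
    rcases zmod3_cases m with rfl | rfl | rfl <;> simp [e2, e3] <;> lia
  · left
    lia

/-- In a direction with slices of sizes 45, 45, 22, the rows of the slice matrix are either
constant or of a rigid shape. -/
theorem matrix_45_45_22 (hV : Fintype.card V = 3 ^ 6) {S : Finset V} (hS : CapSet S)
    {χ : Module.Dual (ZMod 3) V} (h0 : cnt S χ 0 = 45) (h1 : cnt S χ 1 = 45)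
    (h2 : cnt S χ 2 = 22) {u : Module.Dual (ZMod 3) V} (hu : Indep χ u) :
    (∃ i j, ∀ m, cnt (row S χ 0) u m = (if m = i then 9 else 18) ∧
      cnt (row S χ 1) u m = (if m = j then 9 else 18) ∧
      cnt (row S χ 2) u m = if m = -i - j then 4 else 9) ∨
    ∀ m, cnt (row S χ 0) u m = 15 ∧ cnt (row S χ 1) u m = 15 := by
  have hM := hV.trans (pow_succ' 3 5)
  have hχ := hu.ne_zero_left
  have k1 : ∀ v, Indep χ v → _ := fun v hv =>
    certificate (F₀ := anyTriple) (F₁ := anyTriple) (nrm := true) (T := 45)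
      (p := ⟨0, 0, 0, 22, 0, 0, 0, 6⟩) (q := ⟨72900, 1, 1, 0, 0, 0, 0, 0⟩)
      sliceProp_five cyclicInv_slices₅ hV hS h0 h1 h2 (fun _ => ⟨rfl, rfl⟩) slices₅_le
      (by decide +kernel) hv rfl fun _ _ => rfl
  have k2 : ∀ v, Indep χ v → _ := fun v hv =>
    certificate (F₀ := anyTriple) (F₁ := anyTriple) (nrm := true) (T := 45)
      (p := ⟨0, 1, 0, 20, 0, 0, 0, 6⟩) (q := ⟨72900, 0, 1, 0, 0, 0, 0, 0⟩)
      sliceProp_five cyclicInv_slices₅ hV hS h0 h1 h2 (fun _ => ⟨rfl, rfl⟩) slices₅_le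
      (by decide +kernel) hv rfl fun _ _ => rfl
  have d1 := (duality hM hS hχ _ _ k1).2 u hu
  have d2 := (duality hM hS hχ _ _ k2).2 u hu
  have adm := admissible (F₀ := anyTriple) (F₁ := anyTriple) sliceProp_five hV hS hu rfl
    fun _ _ => rfl
  have k1 := k1 u hu
  have k2 := k2 u hu
  rw [h0, h1, h2] at d1 d2 adm
  obtain ⟨sa, sb, sc, ra, rb, -, tr, -, -, -⟩ := adm
  generalize cnt (row S χ 0) u = a at *
  generalize cnt (row S χ 1) u = b at *
  generalize cnt (row S χ 2) u = c at *
  have tr' (i j k : ZMod 3) (hk : k = -i - j) : a i + b j + c k ≤ 45 := by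
    subst hk; exact slices₅_le _ _ _ (tr i j)
  simp only [Weights.eval, Weights.total, Weights.const, tri_eq, sq, cu, Nat.add_eq, Nat.mul_eq]
    at d1 d2 k1 k2
  have t1 := tr' 0 0 0 rfl
  have t2 := tr' 0 1 2 rfl
  have t3 := tr' 0 2 1 rfl
  have t4 := tr' 1 0 2 rfl
  have t5 := tr' 1 1 1 rfl
  have t6 := tr' 1 2 0 rfl
  have t7 := tr' 2 0 1 rfl
  have t8 := tr' 2 1 0 rfl
  have t9 := tr' 2 2 2 rfl
  clear tr tr'
  have ea := slice_entries ra sa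
  have eb := slice_entries rb sb
  clear ra rb sa sb
  have e1 : (0 : ZMod 3) ≠ 1 := by decide
  have e2 : (0 : ZMod 3) ≠ 2 := by decide
  have e3 : (1 : ZMod 3) ≠ 2 := by decide
  have f1 : (-1 : ZMod 3) = 2 := rfl
  have f2 : (-2 : ZMod 3) = 1 := rfl
  have f3 : (2 - 1 : ZMod 3) = 1 := rfl
  have f4 : (2 - 2 : ZMod 3) = 0 := rfl
  have f5 : (1 - 1 : ZMod 3) = 0 := rfl
  have f6 : (1 - 2 : ZMod 3) = 2 := rfl
  rcases ea with ⟨a0, a1, a2⟩ | ⟨i, hi⟩ <;> rcases eb with ⟨b0, b1, b2⟩ | ⟨j, hj⟩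
  · right
    intro m
    rcases zmod3_cases m with rfl | rfl | rfl
    exacts [⟨a0, b0⟩, ⟨a1, b1⟩, ⟨a2, b2⟩]
  · exfalso
    rw [a0, a1, a2, hj, hj, hj] at d1 d2 k1 k2
    rcases zmod3_cases j with rfl | rfl | rfl <;>
      simp only [e1, e2, e3, e1.symm, e2.symm, e3.symm, if_true, if_false] at d1 d2 k1 k2 <;> lia
  · exfalso
    rw [b0, b1, b2, hi, hi, hi] at d1 d2 k1 k2
    rcases zmod3_cases i with rfl | rfl | rfl <;>
      simp only [e1, e2, e3, e1.symm, e2.symm, e3.symm, if_true, if_false] at d1 d2 k1 k2 <;> lia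
  · refine .inl ⟨i, j, fun m => ⟨hi m, hj m, ?_⟩⟩
    simp only [hi, hj] at d1 d2 k1 k2 t1 t2 t3 t4 t5 t6 t7 t8 t9
    rcases zmod3_cases i with rfl | rfl | rfl <;> rcases zmod3_cases j with rfl | rfl | rfl <;>
    simp only [e1, e2, e3, e1.symm, e2.symm, e3.symm, if_true, if_false, f1, f2, f3, f4, f5, f6,
      neg_zero, sub_zero, zero_sub] at d1 d2 k1 k2 t1 t2 t3 t4 t5 t6 t7 t8 t9 ⊢ <;>
    rcases zmod3_cases m with rfl | rfl | rfl <;>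
    simp only [e1, e2, e3, e1.symm, e2.symm, e3.symm, if_true, if_false] <;> lia

end Six

section Column
variable {V : Type} [AddCommGroup V] [Module (ZMod 3) V] [Fintype V] [DecidableEq V]

theorem Shape.neg {S : Finset V} {x y : ℕ} {u : Module.Dual (ZMod 3) V} {p : ZMod 3}
    (h : Shape S x y u p) : Shape S x y (-u) (-p) := fun m => by
  rw [cnt_neg, h]
  simp only [neg_eq_iff_eq_neg]

theorem Shape.unique {S : Finset V} {x y x' y' : ℕ} {u : Module.Dual (ZMod 3) V} {p q : ZMod 3}
    (h : Shape S x y u p) (hxy : x ≠ y) (h' : Shape S x' y' u q) : p = q := by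
  by_contra hpq
  have e1 := h p
  have e2 := h (-p - q)
  rw [h', if_neg hpq, if_pos rfl] at e1
  have h3 : ∀ p q : ZMod 3, p ≠ q → -p - q ≠ p ∧ -p - q ≠ q := by decide
  rw [h', if_neg (h3 p q hpq).1, if_neg (h3 p q hpq).2] at e2
  exact hxy (e1.symm.trans e2)

theorem cnt_row_add_left (S : Finset V) (χ u : Module.Dual (ZMod 3) V) (v : V) (i m : ZMod 3) :
    cnt (row {x | v + x ∈ S} χ i) u m = cnt (row S χ (i + χ v)) u (m + u v) := by
  rw [← cnt_add_left]
  congr 1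
  ext x
  simp only [row, mem_filter, mem_univ, true_and, map_add]
  rw [add_comm (χ v), add_left_inj]

/-- The lines of functionals in the direction of a functional with slices of sizes 45, 45, 22. -/
theorem column (hV : Fintype.card V = 3 ^ 6) {S : Finset V} (hS : CapSet S)
    {χ u : Module.Dual (ZMod 3) V} {p : ZMod 3} (hχ : Shape S 22 45 χ p) (hu : Indep χ u) :
    (sq (cnt (row S χ (p + 1)) u 0) (cnt (row S χ (p + 1)) u 1) (cnt (row S χ (p + 1)) u 2) = 729 ∧
      ∃ k s, ∀ r, Shape S (if r = s then 22 else 40) (if r = s then 45 else 36) (u + r • χ)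
        (k + r * p)) ∨
    (sq (cnt (row S χ (p + 1)) u 0) (cnt (row S χ (p + 1)) u 1) (cnt (row S χ (p + 1)) u 2) = 675 ∧
      ∃ c : ZMod 3 → ℕ, ∀ r m, cnt S (u + r • χ) m = 30 + c (m - r * p)) := by
  obtain ⟨v, hv, hv'⟩ := hu (p + 1) 0
  have e (i m) : cnt (row {x | v + x ∈ S} χ i) u m = cnt (row S χ (i + (p + 1))) u m := by
    rw [cnt_row_add_left, hv, hv', add_zero]
  have hd (r m) : cnt S (u + r • χ) m = cnt (row S χ (0 + (p + 1))) u (m - r * (p + 1)) +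
      cnt (row S χ (1 + (p + 1))) u (m - r * (p + 1) - r) +
      cnt (row S χ (2 + (p + 1))) u (m - r * (p + 1) - 2 * r) := by
    rw [← e, ← e, ← e, ← cnt_eq_diag, cnt_add_left]
    simp [hv, hv']
  have e1 : (0 : ZMod 3) ≠ 1 := by decide
  have e2 : (0 : ZMod 3) ≠ 2 := by decide
  have e3 : (1 : ZMod 3) ≠ 2 := by decide
  have g : ∀ p : ZMod 3, 0 + (p + 1) ≠ p ∧ 1 + (p + 1) ≠ p ∧ 2 + (p + 1) = p := by decide
  have h := matrix_45_45_22 hV (hS.add_left v) (χ := χ) (u := u)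
    (by rw [cnt_add_left, hv, hχ, if_neg (g p).1]) (by rw [cnt_add_left, hv, hχ, if_neg (g p).2.1])
    (by rw [cnt_add_left, hv, hχ, if_pos (g p).2.2]) hu
  simp only [e] at h
  rw [zero_add] at h hd
  rcases h with ⟨i, j, h⟩ | h
  · refine .inl ⟨?_, -i - j, i - j, fun r m => ?_⟩
    · rw [(h 0).1, (h 1).1, (h 2).1]
      rcases zmod3_cases i with rfl | rfl | rfl <;>
      simp only [e1, e2, e3, e1.symm, e2.symm, e3.symm, if_true, if_false] <;> rfl
    · rw [hd, (h _).1, (h _).2.1, (h _).2.2]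
      clear * -
      revert i j r m p
      decide +kernel
  · refine .inr ⟨?_, cnt (row S χ (2 + (p + 1))) u, fun r m => ?_⟩
    · rw [(h 0).1, (h 1).1, (h 2).1]
      rfl
    · rw [hd, (h _).1, (h _).2]
      congr 2
      have : (3 : ZMod 3) = 0 := rfl
      linear_combination -r * this

/-- The functionals for which `S` has slices of sizes 45, 45, 22. -/
noncomputable def odd (S : Finset V) : Finset (Module.Dual (ZMod 3) V) :=
  open Classical in {u | ∃ p, Shape S 22 45 u p}

theorem mem_odd {S : Finset V} {u : Module.Dual (ZMod 3) V} :
    u ∈ odd S ↔ ∃ p, Shape S 22 45 u p := by simp [odd]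

theorem neg_mem_odd {S : Finset V} {u : Module.Dual (ZMod 3) V} : -u ∈ odd S ↔ u ∈ odd S := by
  simp only [mem_odd]
  exact ⟨fun ⟨p, h⟩ => ⟨-p, by simpa using h.neg⟩, fun ⟨p, h⟩ => ⟨-p, h.neg⟩⟩

theorem zero_notMem_odd (S : Finset V) : (0 : Module.Dual (ZMod 3) V) ∉ odd S := by
  rw [mem_odd]
  rintro ⟨p, h⟩
  have h1 := h 1
  have c1 : cnt S 0 1 = 0 := by simp [cnt]
  rw [c1] at h1
  split_ifs at h1

theorem Shape.notMem_odd {S : Finset V} {u : Module.Dual (ZMod 3) V} {p : ZMod 3}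
    (h : Shape S 40 36 u p) : u ∉ odd S := by
  rw [mem_odd]
  rintro ⟨q, h'⟩
  have := h 0
  rw [h'] at this
  split_ifs at this <;> lia

/-- A line of functionals in an odd direction contains at most one odd functional. -/
theorem eq_of_add_smul_mem_odd (hV : Fintype.card V = 3 ^ 6) {S : Finset V} (hS : CapSet S)
    {χ u : Module.Dual (ZMod 3) V} (hχ : χ ∈ odd S) (hu : Indep χ u) {r s : ZMod 3}
    (hr : u + r • χ ∈ odd S) (hs : u + s • χ ∈ odd S) : r = s := by
  obtain ⟨p, hp⟩ := mem_odd.1 hχ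
  rcases column hV hS hp hu with ⟨-, k, t, h⟩ | ⟨-, c, h⟩
  · have key {r} (hr : u + r • χ ∈ odd S) : r = t := by
      by_contra hrt
      have := h r
      rw [if_neg hrt, if_neg hrt] at this
      exact this.notMem_odd hr
    rw [key hr, key hs]
  · obtain ⟨q, hq⟩ := mem_odd.1 hr
    have := hq q
    rw [h, if_pos rfl] at this
    lia

theorem capSet_odd (hV : Fintype.card V = 3 ^ 6) {S : Finset V} (hS : CapSet S) :
    CapSet (odd S) := by
  intro a ha b hb c hc h
  have hc' : c = -a - b := by rw [← sub_eq_zero, ← h]; abel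
  have ha0 : a ≠ 0 := by rintro rfl; exact zero_notMem_odd S ha
  rcases indep_or ha0 b with hi | rfl | rfl | rfl
  · exfalso
    rw [hc', ← neg_mem_odd] at hc
    have : (0 : ZMod 3) = 1 := eq_of_add_smul_mem_odd hV hS ha hi (by simpa using hb)
      (by rw [one_smul]; convert hc using 1; abel)
    exact absurd this (by decide)
  · exact absurd hb (zero_notMem_odd S)
  · refine ⟨rfl, ?_⟩
    rw [hc', ← sub_eq_zero, ← add_self_add_self b]
    abel
  · rw [hc'] at hc
    exact absurd (by simpa using hc) (zero_notMem_odd S)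

theorem filter_not_indep {χ : Module.Dual (ZMod 3) V} (hχ : χ ≠ 0) [DecidablePred (Indep χ)]
    [DecidableEq (Module.Dual (ZMod 3) V)] :
    (univ.filter fun u => ¬ Indep χ u) = {0, χ, -χ} := by
  ext u
  simp only [mem_filter, mem_univ, true_and, mem_insert, mem_singleton]
  constructor
  · intro hu
    exact (indep_or hχ u).resolve_left hu
  · rintro hu hi
    have := hi.ne
    tauto

theorem sum_indep_add {χ : Module.Dual (ZMod 3) V} (hχ : χ ≠ 0) [DecidablePred (Indep χ)]
    (F : Module.Dual (ZMod 3) V → ℕ) :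
    ∑ u with Indep χ u, F u + (F 0 + F χ + F (-χ)) = ∑ u, F u := by
  classical
  rw [← sum_filter_add_sum_filter_not univ (fun u => Indep χ u) F, filter_not_indep hχ,
    sum_insert (by simp [hχ, hχ.symm]), sum_insert (by simpa using neg_ne_self hχ), sum_singleton,
    add_assoc]

theorem sq_row_smul (S : Finset V) (χ : Module.Dual (ZMod 3) V) (r i : ZMod 3) :
    sq (cnt (row S χ i) (r • χ) 0) (cnt (row S χ i) (r • χ) 1) (cnt (row S χ i) (r • χ) 2) =
      cnt S χ i * cnt S χ i := by
  simp only [cnt_row_self, sq, Nat.add_eq, Nat.mul_eq]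
  generalize r * i = j
  have e1 : (0 : ZMod 3) ≠ 1 := by decide
  have e2 : (0 : ZMod 3) ≠ 2 := by decide
  have e3 : (1 : ZMod 3) ≠ 2 := by decide
  rcases zmod3_cases j with rfl | rfl | rfl <;> simp [e1, e2, e3, e1.symm, e2.symm, e3.symm]

theorem card_odd (hV : Fintype.card V = 3 ^ 6) {S : Finset V} (hS : CapSet S)
    {χ : Module.Dual (ZMod 3) V} (hχ : χ ∈ odd S) : #(odd S) = 112 := by
  classical
  obtain ⟨p, hp⟩ := mem_odd.1 hχ
  have hχ0 : χ ≠ 0 := by rintro rfl; exact zero_notMem_odd S hχ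
  set F : Module.Dual (ZMod 3) V → ℕ := fun u =>
    sq (cnt (row S χ (p + 1)) u 0) (cnt (row S χ (p + 1)) u 1) (cnt (row S χ (p + 1)) u 2) with hF
  set O : Module.Dual (ZMod 3) V → ℕ := fun u => if u ∈ odd S then 1 else 0 with hO
  have h45 : cnt S χ (p + 1) = 45 := by rw [hp, if_neg (by simp)]
  have sF := sum_sq (hV.trans (pow_succ' 3 5)) (row S χ (p + 1))
  rw [card_row, h45] at sF
  change ∑ u, F u = _ at sF
  rw [← sum_indep_add hχ0] at sF
  have f0 := sq_row_smul S χ 0 (p + 1)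
  have f1 := sq_row_smul S χ 1 (p + 1)
  have f2 := sq_row_smul S χ (-1) (p + 1)
  rw [zero_smul, h45] at f0
  rw [one_smul, h45] at f1
  rw [show (-1 : ZMod 3) • χ = -χ from LinearMap.ext fun v => by simp, h45] at f2
  change F 0 = _ at f0
  change F χ = _ at f1
  change F (-χ) = _ at f2
  rw [f0, f1, f2] at sF
  have hcard := sum_indep_add hχ0 fun _ => 1
  rw [← card_eq_sum_ones, ← card_eq_sum_ones, card_univ, card_dual, hV] at hcard
  have hline (u) (hu : Indep χ u) : F u = 675 + 54 * ∑ r : ZMod 3, O (u + r • χ) := by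
    rcases column hV hS hp hu with ⟨h1, k, s, h⟩ | ⟨h1, c, h⟩
    · have : ∀ r, O (u + r • χ) = if r = s then 1 else 0 := fun r => by
        simp only [hO]
        have := h r
        by_cases hr : r = s
        · rw [if_pos hr, if_pos hr] at this
          rw [if_pos hr, if_pos (mem_odd.2 ⟨_, this⟩)]
        · rw [if_neg hr, if_neg hr] at this
          rw [if_neg hr, if_neg this.notMem_odd]
      simp only [this, sum_ite_eq', mem_univ, if_true, hF, h1]
    · have : ∀ r, O (u + r • χ) = 0 := fun r => by
        simp only [hO, ite_eq_right_iff, one_ne_zero, imp_false, mem_odd]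
        rintro ⟨q, hq⟩
        have := hq q
        rw [h, if_pos rfl] at this
        lia
      simp only [this, sum_const_zero, hF, h1, mul_zero, add_zero]
  have hshift (r : ZMod 3) : ∑ u with Indep χ u, O (u + r • χ) = ∑ u with Indep χ u, O u := by
    refine sum_nbij' (fun u => u + r • χ) (fun u => u + (-r) • χ) ?_ ?_ ?_ ?_ ?_
    · simp only [mem_filter, mem_univ, true_and]
      exact fun u hu => hu.add_smul r
    · simp only [mem_filter, mem_univ, true_and]
      exact fun u hu => hu.add_smul _
    · exact fun u _ => LinearMap.ext fun x => by simp
    · exact fun u _ => LinearMap.ext fun x => by simp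
    · simp
  rw [sum_congr rfl fun u hu => hline u (by simpa using hu), sum_add_distrib, sum_const,
    ← mul_sum, sum_comm, sum_congr rfl fun r _ => hshift r, sum_const, card_univ, ZMod.card,
    smul_eq_mul, smul_eq_mul] at sF
  have hodd := sum_indep_add hχ0 O
  have o0 : O 0 = 0 := by simp [hO, zero_notMem_odd]
  have o1 : O χ = 1 := by simp [hO, hχ]
  have o2 : O (-χ) = 1 := by simp [hO, hχ, neg_mem_odd]
  have o3 : ∑ u, O u = #(odd S) := by simp [hO]
  rw [o0, o1, o2, o3] at hodd
  norm_num at sF hcard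
  lia

end Column

/-! ### Character sums of symmetric caps -/

/-- Twice the real part of the additive character of `ZMod 3`. -/
def kappa (m : ZMod 3) : ℤ := if m = 0 then 2 else -1

theorem kappa_zero : kappa 0 = 2 := rfl

theorem kappa_mul : ∀ s t, kappa s * kappa t = kappa (s + t) + kappa (s - t) := by decide

theorem kappa_neg : ∀ s, kappa (-s) = kappa s := by decide

theorem kappa_eq : ∀ s, kappa s = 3 * (if s = 0 then 1 else 0) - 1 := by decide

section Character
variable {V : Type} [AddCommGroup V] [Module (ZMod 3) V] [Fintype V] [DecidableEq V]

/-- Twice the real part of the Fourier transform of the indicator function of `S`. -/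
def rho (S : Finset V) (u : Module.Dual (ZMod 3) V) : ℤ := ∑ a ∈ S, kappa (u a)

def Symm (S : Finset V) : Prop := ∀ a ∈ S, -a ∈ S

theorem Symm.neg_mem {S : Finset V} (h : Symm S) {a : V} : -a ∈ S ↔ a ∈ S :=
  ⟨fun ha => neg_neg a ▸ h _ ha, h a⟩

theorem rho_eq (S : Finset V) (u : Module.Dual (ZMod 3) V) : rho S u = 3 * cnt S u 0 - #S := by
  simp only [rho, kappa_eq, sum_sub_distrib, ← mul_sum, sum_boole, cnt, sum_const, nsmul_eq_mul,
    mul_one]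

theorem sum_kappa (v : V) (hV : ∃ M, Fintype.card V = 3 * M) :
    ∑ u : Module.Dual (ZMod 3) V, kappa (u v) = if v = 0 then 2 * (Fintype.card V : ℤ) else 0 := by
  obtain ⟨M, hM⟩ := hV
  split_ifs with h
  · simp [h, kappa_zero, card_dual, mul_comm]
  · simp only [kappa_eq, sum_sub_distrib, ← mul_sum, sum_boole, card_annihilator hM h, sum_const,
      card_univ, card_dual, hM]
    simp

theorem Symm.rho_mul {S : Finset V} (hS : Symm S) (u : Module.Dual (ZMod 3) V) (c : V) :
    rho S u * kappa (u c) = 2 * ∑ a ∈ S, kappa (u (a + c)) := by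
  have : ∑ a ∈ S, kappa (u a - u c) = ∑ a ∈ S, kappa (u a + u c) := by
    refine sum_nbij' (fun a => -a) (fun a => -a) hS hS (by simp) (by simp) fun a _ => ?_
    rw [← kappa_neg, map_neg]
    congr 1
    ring
  simp only [rho, sum_mul, kappa_mul, sum_add_distrib, this, map_add]
  ring

theorem Symm.sum_rho_mul {S : Finset V} (hS : Symm S) (hV : ∃ M, Fintype.card V = 3 * M) (c : V) :
    ∑ u, rho S u * kappa (u c) = if c ∈ S then 4 * (Fintype.card V : ℤ) else 0 := by
  simp only [hS.rho_mul, ← mul_sum]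
  rw [sum_comm]
  simp only [sum_kappa _ hV, add_eq_zero_iff_eq_neg, sum_ite_eq', hS.neg_mem]
  split_ifs <;> ring

theorem Symm.sum_rho_mul_rho_mul {S T : Finset V} (hS : Symm S) (hT : Symm T)
    (hV : ∃ M, Fintype.card V = 3 * M) {c : V} (h : ∀ a ∈ S, ∀ b ∈ T, a + b + c ≠ 0) :
    ∑ u, rho S u * rho T u * kappa (u c) = 0 := by
  have (u : Module.Dual (ZMod 3) V) : rho S u * rho T u * kappa (u c) =
      4 * ∑ b ∈ T, ∑ a ∈ S, kappa (u (a + (b + c))) := by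
    rw [mul_assoc, hT.rho_mul, mul_left_comm, mul_sum, sum_congr rfl fun b _ => hS.rho_mul u _,
      ← mul_sum]
    ring
  simp only [this, ← mul_sum]
  rw [sum_comm, sum_congr rfl fun b _ => sum_comm, mul_eq_zero]
  refine .inr (sum_eq_zero fun b hb => sum_eq_zero fun a ha => ?_)
  rw [sum_kappa _ hV, if_neg]
  rw [← add_assoc]
  exact h a ha b hb

theorem Symm.cnt {S : Finset V} (hS : Symm S) (u : Module.Dual (ZMod 3) V) :
    cnt S u 1 = cnt S u 2 := by
  refine card_nbij' (fun a => -a) (fun a => -a) ?_ ?_ (fun a _ => neg_neg a) (fun a _ => neg_neg a)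
  · intro a ha
    simp only [coe_filter, Set.mem_ofPred_eq] at ha ⊢
    exact ⟨hS a ha.1, by rw [map_neg, ha.2]; rfl⟩
  · intro a ha
    simp only [coe_filter, Set.mem_ofPred_eq] at ha ⊢
    exact ⟨hS a ha.1, by rw [map_neg, ha.2]; rfl⟩

theorem Symm.zero_notMem {S : Finset V} (hS : Symm S) (hcap : CapSet S) (hc : #S = 112) :
    0 ∉ S := by
  intro h0
  have : S ⊆ {0} := fun a ha => by
    have := (hcap a ha (-a) (hS a ha) 0 h0 (by simp)).2
    simpa using this
  have := card_le_card this
  rw [hc, card_singleton] at this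
  lia

/-- A symmetric cap with 112 points in dimension six is a two-weight set. -/
theorem Symm.cnt_eq {S : Finset V} (hS : Symm S) (hV : Fintype.card V = 3 ^ 6) (hcap : CapSet S)
    (hc : #S = 112) {u : Module.Dual (ZMod 3) V} (hu : u ≠ 0) :
    CapSlice.cnt S u 0 = 22 ∨ CapSlice.cnt S u 0 = 40 := by
  classical
  have hM := hV.trans (pow_succ' 3 5)
  set P : Module.Dual (ZMod 3) V → ℤ := fun u =>
    ((CapSlice.cnt S u 0 : ℤ) - 22) * ((CapSlice.cnt S u 0 : ℤ) - 40) ^ 2 with hP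
  have hsum (u) : (CapSlice.cnt S u 0 : ℤ) = 112 - 2 * CapSlice.cnt S u 2 := by
    have h1 := cnt_sum S u
    rw [hS.cnt, hc] at h1
    lia
  have hPu (u) : 9 * P u =
      4 * (cu (CapSlice.cnt S u 0) (CapSlice.cnt S u 1) (CapSlice.cnt S u 2) : ℕ) +
      60 * (sq (CapSlice.cnt S u 0) (CapSlice.cnt S u 1) (CapSlice.cnt S u 2) : ℕ) -
      672 * (CapSlice.cnt S u 0 : ℕ) - 2098048 := by
    simp only [hP, cu, sq, Nat.add_eq, Nat.mul_eq]
    push_cast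
    rw [hS.cnt, hsum]
    ring
  have h0 : ∑ u, CapSlice.cnt S u 0 = 3 ^ 5 * 112 := by
    have := sum_card_annihilated hM S id
    rw [hc] at this
    simp only [CapSlice.cnt]
    refine this.trans ?_
    have : {a ∈ S | id a = 0} = ∅ := filter_eq_empty_iff.2 fun a ha (h : a = 0) =>
      hS.zero_notMem hcap hc (by rwa [h] at ha)
    rw [this, card_empty, mul_zero, add_zero]
  have h1 := sum_sq hM S
  have h2 := hcap.sum_cu hM
  have hall : 9 * ∑ u, P u = 4199040 := by
    rw [mul_sum, sum_congr rfl fun u _ => hPu u]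
    simp only [sum_sub_distrib, sum_add_distrib, ← mul_sum, ← Nat.cast_sum, h0, h1, h2, hc,
      sum_const, card_univ, card_dual, hV]
    norm_num
  have hP0 : P 0 = 466560 := by
    have : CapSlice.cnt S 0 0 = 112 := by simp [CapSlice.cnt, hc]
    simp only [hP, this]
    norm_num
  have hne : ∑ u ∈ univ.erase 0, P u = 0 := by
    have := sum_erase_add univ P (mem_univ 0)
    lia
  have hnn : ∀ u ∈ univ.erase (0 : Module.Dual (ZMod 3) V), 0 ≤ P u := fun u hu => by
    have hb := capBound_five.cnt_le hV hcap (ne_of_mem_erase hu) 2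
    have := hsum u
    exact mul_nonneg (by lia) (sq_nonneg _)
  have := (sum_eq_zero_iff_of_nonneg hnn).1 hne u (mem_erase.2 ⟨hu, mem_univ _⟩)
  rw [hP, mul_eq_zero, sq_eq_zero_iff] at this
  lia

/-- The nonzero functionals of the smaller weight. -/
noncomputable def light (S : Finset V) : Finset (Module.Dual (ZMod 3) V) :=
  open Classical in {u | u ≠ 0 ∧ cnt S u 0 = 22}

theorem Symm.rho_eq {S : Finset V} (hS : Symm S) (hV : Fintype.card V = 3 ^ 6) (hcap : CapSet S)
    (hc : #S = 112) [DecidableEq (Module.Dual (ZMod 3) V)] (u : Module.Dual (ZMod 3) V) :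
    rho S u = 8 - 54 * (if u ∈ light S then 1 else 0) + 216 * if u = 0 then 1 else 0 := by
  rw [CapSlice.rho_eq, hc]
  by_cases hu : u = 0
  · have : u ∉ light S := by simp [light, hu]
    rw [if_neg this, if_pos hu, hu]
    have : CapSlice.cnt S 0 0 = 112 := by simp [CapSlice.cnt, hc]
    rw [this]
    norm_num
  · rcases hS.cnt_eq hV hcap hc hu with h | h
    · have : u ∈ light S := by simp [light, hu, h]
      rw [if_pos this, if_neg hu, h]
      norm_num
    · have : u ∉ light S := by simp [light, h]
      rw [if_neg this, if_neg hu, h]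
      norm_num

theorem Symm.exists_add {S : Finset V} (hS : Symm S) (hV : Fintype.card V = 3 ^ 6)
    (hcap : CapSet S) (hc : #S = 112) {x : V} (hx : x ≠ 0) (hxS : x ∉ S) :
    ∃ a ∈ S, ∃ b ∈ S, a + b = x := by
  classical
  by_contra! h
  have hM : ∃ M, Fintype.card V = 3 * M := ⟨_, hV.trans (pow_succ' 3 5)⟩
  have h1 := hS.sum_rho_mul_rho_mul hS hM (c := -x) fun a ha b hb => by
    rw [Ne, add_neg_eq_zero]
    exact h a ha b hb
  have h2 := hS.sum_rho_mul hM (-x)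
  rw [if_neg (by rwa [hS.neg_mem])] at h2
  have h3 := sum_kappa (-x) hM
  rw [if_neg (neg_ne_zero.2 hx)] at h3
  have key (u : Module.Dual (ZMod 3) V) : rho S u * rho S u * kappa (u (-x)) =
      -38 * (rho S u * kappa (u (-x))) + 368 * kappa (u (-x)) + if u = 0 then 116640 else 0 := by
    by_cases hu : u = 0
    · rw [hS.rho_eq hV hcap hc, if_pos hu, if_pos hu, hu, if_neg (by simp [light])]
      simp [kappa_zero]
    · rw [hS.rho_eq hV hcap hc, if_neg hu, if_neg hu]
      split_ifs <;> ring
  rw [sum_congr rfl fun u _ => key u, sum_add_distrib, sum_add_distrib, ← mul_sum, ← mul_sum, h2,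
    h3, sum_ite_eq'] at h1
  simp at h1

end Character

/-! ### Caps of size 112 in dimension six are centrally symmetric -/

section Center
variable {V : Type} [AddCommGroup V] [Module (ZMod 3) V] [Fintype V] [DecidableEq V]

/-- `q` is the exceptional value of `u` on `S`. -/
def Pos (S : Finset V) (u : Module.Dual (ZMod 3) V) (q : ZMod 3) : Prop :=
  ∃ x y, x ≠ y ∧ Shape S x y u q

theorem Pos.unique {S : Finset V} {u : Module.Dual (ZMod 3) V} {p q : ZMod 3} (h : Pos S u p)
    (h' : Pos S u q) : p = q := by
  obtain ⟨x, y, hxy, h⟩ := h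
  obtain ⟨_, _, -, h'⟩ := h'
  exact h.unique hxy h'

theorem pos_of_shape {S : Finset V} {u : Module.Dual (ZMod 3) V} {p : ZMod 3}
    (h : Shape S 22 45 u p) : Pos S u p := ⟨22, 45, by decide, h⟩

theorem pos_zero {S : Finset V} (hc : #S = 112) : Pos S 0 0 := by
  refine ⟨112, 0, by decide, fun m => ?_⟩
  split_ifs with h
  · simp [cnt, h, hc]
  · simp [cnt, Ne.symm h]

theorem Pos.add_odd (hV : Fintype.card V = 3 ^ 6) {S : Finset V} (hS : CapSet S) (hc : #S = 112)
    {χ u : Module.Dual (ZMod 3) V} {p q : ZMod 3} (hu : Pos S u q) (hχ : Shape S 22 45 χ p) :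
    Pos S (u + χ) (q + p) := by
  have hχ0 : χ ≠ 0 := by rintro rfl; exact zero_notMem_odd S (mem_odd.2 ⟨p, hχ⟩)
  rcases indep_or hχ0 u with hi | rfl | rfl | rfl
  · rcases column hV hS hχ hi with ⟨-, k, s, h⟩ | ⟨-, c, h⟩
    · have hpos (r : ZMod 3) : Pos S (u + r • χ) (k + r * p) :=
        ⟨_, _, by split_ifs <;> decide, h r⟩
      have h0 := hpos 0
      have h1 := hpos 1
      rw [zero_smul, add_zero, zero_mul, add_zero] at h0
      rw [one_smul, one_mul] at h1
      rwa [hu.unique h0]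
    · obtain ⟨x, y, hxy, hu⟩ := hu
      refine ⟨x, y, hxy, fun m => ?_⟩
      have h0 := h 0 (m - p)
      have h1 := h 1 m
      rw [zero_smul, add_zero, zero_mul, sub_zero, hu] at h0
      rw [one_smul, one_mul] at h1
      rw [h1, ← h0]
      simp only [sub_eq_iff_eq_add]
  · rw [hu.unique (pos_zero hc), zero_add, zero_add]
    exact pos_of_shape hχ
  · rw [hu.unique (pos_of_shape hχ)]
    have h1 : u + u = -u := eq_neg_of_add_eq_zero_left (add_self_add_self u)
    have h2 : p + p = -p := eq_neg_of_add_eq_zero_left (add_self_add_self p)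
    rw [h1, h2]
    exact pos_of_shape hχ.neg
  · rw [hu.unique (pos_of_shape hχ.neg), neg_add_cancel, neg_add_cancel]
    exact pos_zero hc

theorem exists_odd_add (hV : Fintype.card V = 3 ^ 6) {S : Finset V} (hS : CapSet S)
    (hc : #S = 112) (u : Module.Dual (ZMod 3) V) :
    u = 0 ∨ u ∈ odd S ∨ ∃ a ∈ odd S, ∃ b ∈ odd S, a + b = u := by
  classical
  by_cases hu : u = 0
  · exact .inl hu
  by_cases hu' : u ∈ odd S
  · exact .inr (.inl hu')
  obtain ⟨χ, p, hχ⟩ := exists_shape hV hS hc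
  exact .inr (.inr (Symm.exists_add (fun a => neg_mem_odd.2) (card_dual.trans hV) (capSet_odd hV hS)
    (card_odd hV hS (mem_odd.2 ⟨p, hχ⟩)) hu hu'))

theorem exists_pos (hV : Fintype.card V = 3 ^ 6) {S : Finset V} (hS : CapSet S) (hc : #S = 112)
    (u : Module.Dual (ZMod 3) V) : ∃ q, Pos S u q := by
  rcases exists_odd_add hV hS hc u with rfl | h | ⟨a, ha, b, hb, rfl⟩
  · exact ⟨0, pos_zero hc⟩
  · exact (mem_odd.1 h).imp fun _ => pos_of_shape
  · obtain ⟨p, hp⟩ := mem_odd.1 ha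
    obtain ⟨q, hq⟩ := mem_odd.1 hb
    exact ⟨_, (pos_of_shape hp).add_odd hV hS hc hq⟩

theorem Pos.add (hV : Fintype.card V = 3 ^ 6) {S : Finset V} (hS : CapSet S) (hc : #S = 112)
    {u w : Module.Dual (ZMod 3) V} {p q : ZMod 3} (hu : Pos S u p) (hw : Pos S w q) :
    Pos S (u + w) (p + q) := by
  rcases exists_odd_add hV hS hc w with rfl | h | ⟨a, ha, b, hb, rfl⟩
  · rwa [hw.unique (pos_zero hc), add_zero, add_zero]
  · obtain ⟨r, hr⟩ := mem_odd.1 h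
    rw [hw.unique (pos_of_shape hr)]
    exact hu.add_odd hV hS hc hr
  · obtain ⟨r, hr⟩ := mem_odd.1 ha
    obtain ⟨s, hs⟩ := mem_odd.1 hb
    rw [hw.unique ((pos_of_shape hr).add_odd hV hS hc hs), ← add_assoc, ← add_assoc]
    exact (hu.add_odd hV hS hc hr).add_odd hV hS hc hs

theorem exists_pos_apply (hV : Fintype.card V = 3 ^ 6) {S : Finset V} (hS : CapSet S)
    (hc : #S = 112) : ∃ v : V, ∀ u : Module.Dual (ZMod 3) V, Pos S u (u v) := by
  choose f hf using exists_pos hV hS hc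
  let g : Module.Dual (ZMod 3) V →+ ZMod 3 :=
    { toFun := f
      map_zero' := (hf 0).unique (pos_zero hc)
      map_add' := fun u w => (hf _).unique ((hf u).add hV hS hc (hf w)) }
  refine ⟨(Module.evalEquiv (ZMod 3) V).symm (g.toZModLinearMap 3), fun u => ?_⟩
  rw [Module.apply_evalEquiv_symm_apply]
  exact hf u

theorem symm_of_cnt {M : ℕ} (hM : Fintype.card V = 3 * M) {S : Finset V}
    (h : ∀ u, cnt S u 1 = cnt S u 2) : Symm S := by
  have hcnt (u : Module.Dual (ZMod 3) V) (x : V) : cnt S u (u (-x)) = cnt S u (u x) := by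
    rw [map_neg]
    rcases zmod3_cases (u x) with h' | h' | h' <;> rw [h']
    · rfl
    · exact (h u).symm
    · exact h u
  have hsum (x : V) : ∑ u, cnt S u (u x) = M * #S + 2 * M * if x ∈ S then 1 else 0 := by
    have := sum_card_annihilated hM S fun a => a - x
    simp only [map_sub, sub_eq_zero] at this
    refine this.trans ?_
    rw [filter_eq']
    split_ifs <;> simp
  have hM0 : M ≠ 0 := by
    rintro rfl
    exact Fintype.card_ne_zero hM
  intro a ha
  by_contra hna
  have h1 := hsum a
  rw [← sum_congr rfl fun u _ => hcnt u a, hsum, if_pos ha, if_neg hna] at h1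
  lia

theorem exists_symm_add_left (hV : Fintype.card V = 3 ^ 6) {S : Finset V} (hS : CapSet S)
    (hc : #S = 112) : ∃ v : V, Symm ({x | v + x ∈ S} : Finset V) := by
  obtain ⟨v, hv⟩ := exists_pos_apply hV hS hc
  refine ⟨v, symm_of_cnt (hV.trans (pow_succ' 3 5)) fun u => ?_⟩
  obtain ⟨x, y, -, h⟩ := hv u
  rw [cnt_add_left, cnt_add_left, h, h, if_neg (by simp), if_neg (by simp; decide)]

end Center

/-! ### The middle slice -/

section Middle
variable {V : Type} [AddCommGroup V] [Module (ZMod 3) V] [Fintype V] [DecidableEq V]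

theorem Symm.sum_light {S : Finset V} (hS : Symm S) (hV : Fintype.card V = 3 ^ 6)
    (hcap : CapSet S) (hc : #S = 112) (z : V) :
    ∑ u ∈ light S, kappa (u z) =
      8 - 54 * (if z ∈ S then 1 else 0) + 216 * if z = 0 then 1 else 0 := by
  classical
  have hM : ∃ M, Fintype.card V = 3 * M := ⟨_, hV.trans (pow_succ' 3 5)⟩
  have h1 := hS.sum_rho_mul hM z
  have h2 := sum_kappa z hM
  have key (u : Module.Dual (ZMod 3) V) : rho S u * kappa (u z) =
      8 * kappa (u z) - 54 * (if u ∈ light S then kappa (u z) else 0) +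
        if u = 0 then 432 else 0 := by
    rw [hS.rho_eq hV hcap hc]
    by_cases hu : u = 0
    · simp [hu, kappa_zero, light]
    · rw [if_neg hu, if_neg hu]
      split_ifs <;> ring
  rw [sum_congr rfl fun u _ => key u, sum_add_distrib, sum_sub_distrib, ← mul_sum, ← mul_sum, h2,
    sum_ite_mem, univ_inter, sum_ite_eq',
    if_pos (mem_univ _), hV] at h1
  split_ifs at h1 ⊢ <;> norm_num at h1 ⊢ <;> lia

theorem Symm.card_light {S : Finset V} (hS : Symm S) (hV : Fintype.card V = 3 ^ 6)
    (hcap : CapSet S) (hc : #S = 112) : #(light S) = 112 := by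
  have := hS.sum_light hV hcap hc 0
  simp only [map_zero, kappa_zero, sum_const, nsmul_eq_mul, if_neg (hS.zero_notMem hcap hc)] at this
  norm_num at this
  lia

theorem Symm.sum_light_inter {S T : Finset V} (hS : Symm S) (hT : Symm T)
    (hV : Fintype.card V = 3 ^ 6) (hScap : CapSet S) (hTcap : CapSet T) (hSc : #S = 112)
    (hTc : #T = 112) [DecidableEq (Module.Dual (ZMod 3) V)] {c : V} (hc : c ≠ 0)
    (h : ∀ a ∈ S, ∀ b ∈ T, a + b + c ≠ 0) :
    ∑ u ∈ light S ∩ light T, kappa (u c) =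
      -32 - 8 * ((if c ∈ S then 1 else 0) + if c ∈ T then 1 else 0) := by
  have hM : ∃ M, Fintype.card V = 3 * M := ⟨_, hV.trans (pow_succ' 3 5)⟩
  have h1 := hS.sum_rho_mul_rho_mul hT hM h
  have h2 := sum_kappa c hM
  have hSl := hS.sum_light hV hScap hSc c
  have hTl := hT.sum_light hV hTcap hTc c
  rw [if_neg hc] at h2 hSl hTl
  have key (u : Module.Dual (ZMod 3) V) : rho S u * rho T u * kappa (u c) =
      64 * kappa (u c) - 432 * (if u ∈ light S then kappa (u c) else 0) -
        432 * (if u ∈ light T then kappa (u c) else 0) +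
        2916 * (if u ∈ light S ∩ light T then kappa (u c) else 0) +
        if u = 0 then 100224 else 0 := by
    rw [hS.rho_eq hV hScap hSc, hT.rho_eq hV hTcap hTc]
    by_cases hu : u = 0
    · simp [hu, kappa_zero, light]
    · rw [if_neg hu, if_neg hu]
      by_cases h1 : u ∈ light S <;> by_cases h2 : u ∈ light T <;> simp [h1, h2] <;> ring
  rw [sum_congr rfl fun u _ => key u, sum_add_distrib, sum_add_distrib, sum_sub_distrib,
    sum_sub_distrib, ← mul_sum, ← mul_sum, ← mul_sum, ← mul_sum, h2,
    sum_ite_mem, sum_ite_mem, sum_ite_mem, univ_inter, univ_inter, univ_inter, sum_ite_eq',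
    if_pos (mem_univ _), hSl, hTl] at h1
  lia

/-- A set of points on which a large part of the character sum over `light S` is very negative is
small. -/
theorem Symm.sq_card_le {S : Finset V} (hS : Symm S) (hV : Fintype.card V = 3 ^ 6)
    (hcap : CapSet S) (hc : #S = 112) {D : Finset (Module.Dual (ZMod 3) V)} (hD : D ⊆ light S)
    {W : Finset V} {t : ℤ} (hW : ∀ x ∈ W, x ≠ 0 ∧ x ∉ S ∧ ∑ u ∈ D, kappa (u x) = t) :
    ((8 - 2 * t) * #W) ^ 2 ≤ 112 * (16 * (#W : ℤ) ^ 2 + 432 * #W) := by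
  classical
  set τ : Module.Dual (ZMod 3) V → ℤ := fun u => ∑ x ∈ W, kappa (u x)
  set ε : Module.Dual (ZMod 3) V → ℤ := fun u => if u ∈ D then -1 else 1
  have h1 : ∑ u ∈ light S, ε u * τ u = (8 - 2 * t) * #W := by
    have e (u) : ε u * τ u = τ u - 2 * if u ∈ D then τ u else 0 := by
      simp only [ε]
      split_ifs <;> ring
    rw [sum_congr rfl fun u _ => e u, sum_sub_distrib, ← mul_sum, sum_ite_mem,
      inter_eq_right.2 hD, sum_comm, sum_comm (s := D), mul_sum, ← sum_sub_distrib,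
      sum_congr rfl (g := fun _ => 8 - 2 * t)]
    · rw [sum_const, nsmul_eq_mul, mul_comm]
    · intro x hx
      obtain ⟨h0, hxS, h⟩ := hW x hx
      rw [h, hS.sum_light hV hcap hc, if_neg h0, if_neg hxS]
      ring
  have h2 : ∑ u ∈ light S, ε u ^ 2 = 112 := by
    rw [sum_congr rfl (g := fun _ => 1)]
    · simp [hS.card_light hV hcap hc]
    · intro u _
      simp only [ε]
      split_ifs <;> rfl
  have hσ (z : V) : ∑ u ∈ light S, kappa (u z) ≤ 8 + 216 * if z = 0 then 1 else 0 := by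
    rw [hS.sum_light hV hcap hc]
    split_ifs <;> norm_num
  have h3 : ∑ u ∈ light S, τ u ^ 2 ≤ 16 * (#W : ℤ) ^ 2 + 432 * #W := by
    have e (u) : τ u ^ 2 = ∑ x ∈ W, ∑ y ∈ W, (kappa (u (x + y)) + kappa (u (x - y))) := by
      simp only [τ, pow_two, sum_mul_sum, kappa_mul, map_add, map_sub]
    rw [sum_congr rfl fun u _ => e u, sum_comm, sum_congr rfl fun x _ => sum_comm]
    have hb : ∀ x ∈ W, ∑ y ∈ W, ∑ u ∈ light S, (kappa (u (x + y)) + kappa (u (x - y))) ≤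
        16 * #W + 432 := fun x hx => by
      calc _ ≤ ∑ y ∈ W, (16 + 216 * (if y = -x then (1 : ℤ) else 0) +
            216 * if y = x then (1 : ℤ) else 0) := sum_le_sum fun y _ => by
              have e1 := hσ (x + y)
              have e2 := hσ (x - y)
              rw [sum_add_distrib]
              simp only [add_eq_zero_iff_neg_eq, sub_eq_zero, eq_comm (a := x),
                eq_comm (a := -x)] at e1 e2
              linarith
        _ ≤ _ := by
          simp only [sum_add_distrib, ← mul_sum, sum_ite_eq', sum_const, nsmul_eq_mul]
          split_ifs <;> linarith
    refine (sum_le_sum hb).trans_eq ?_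
    rw [sum_const, nsmul_eq_mul]
    ring
  have := sum_mul_sq_le_sq_mul_sq (light S) ε τ
  rw [h1, h2] at this
  linarith

theorem Symm.card_le {S T : Finset V} (hS : Symm S) (hT : Symm T)
    (hV : Fintype.card V = 3 ^ 6) (hScap : CapSet S) (hTcap : CapSet T) (hSc : #S = 112)
    (hTc : #T = 112) {C : Finset V} (h : ∀ a ∈ S, ∀ b ∈ T, ∀ c ∈ C, a + b + c ≠ 0) :
    #C ≤ 31 := by
  classical
  have hD {c : V} (hc : c ∈ C) (h0 : c ≠ 0) := hS.sum_light_inter hT hV hScap hTcap hSc hTc h0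
    fun a ha b hb => h a ha b hb c hc
  have h1 := hS.sq_card_le hV hScap hSc (D := light S ∩ light T) inter_subset_left
    (W := {c ∈ C | c ≠ 0 ∧ c ∉ S ∧ c ∉ T}) (t := -32) fun c hc => by
      simp only [mem_filter] at hc
      have := hD hc.1 hc.2.1
      rw [if_neg hc.2.2.1, if_neg hc.2.2.2] at this
      exact ⟨hc.2.1, hc.2.2.1, this⟩
  have h2 := hS.sq_card_le hV hScap hSc (D := light S ∩ light T) inter_subset_left
    (W := {c ∈ C | c ≠ 0 ∧ c ∉ S ∧ c ∈ T}) (t := -40) fun c hc => by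
      simp only [mem_filter] at hc
      have := hD hc.1 hc.2.1
      rw [if_neg hc.2.2.1, if_pos hc.2.2.2] at this
      exact ⟨hc.2.1, hc.2.2.1, this⟩
  have h3 := hT.sq_card_le hV hTcap hTc (D := light S ∩ light T) inter_subset_right
    (W := {c ∈ C | c ≠ 0 ∧ c ∈ S ∧ c ∉ T}) (t := -40) fun c hc => by
      simp only [mem_filter] at hc
      have := hD hc.1 hc.2.1
      rw [if_pos hc.2.2.1, if_neg hc.2.2.2] at this
      exact ⟨hc.2.1, hc.2.2.2, this⟩
  have hcover : C ⊆ {0} ∪ ({c ∈ C | c ≠ 0 ∧ c ∉ S ∧ c ∉ T} ∪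
      ({c ∈ C | c ≠ 0 ∧ c ∉ S ∧ c ∈ T} ∪ {c ∈ C | c ≠ 0 ∧ c ∈ S ∧ c ∉ T})) := fun c hc => by
    have : ¬ (c ∈ S ∧ c ∈ T) := fun hST => h c hST.1 c hST.2 c hc (add_self_add_self c)
    simp only [mem_union, mem_filter, mem_singleton, hc, true_and]
    tauto
  have hle := (card_le_card hcover).trans ((card_union_le _ _).trans (add_le_add_right
    ((card_union_le _ _).trans (add_le_add_right (card_union_le _ _) _)) _))
  rw [card_singleton] at hle
  generalize #{c ∈ C | c ≠ 0 ∧ c ∉ S ∧ c ∉ T} = x at *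
  generalize #{c ∈ C | c ≠ 0 ∧ c ∉ S ∧ c ∈ T} = y at *
  generalize #{c ∈ C | c ≠ 0 ∧ c ∈ S ∧ c ∉ T} = z at *
  have hx : x < 15 := by
    by_contra! hx
    zify at hx
    nlinarith
  have hy {y : ℕ} (h : ((8 - 2 * -40) * (y : ℤ)) ^ 2 ≤ 112 * (16 * (y : ℤ) ^ 2 + 432 * y)) :
      y < 9 := by
    by_contra! hy
    zify at hy
    nlinarith
  have := hy h2
  have := hy h3
  lia

theorem card_add_left (S : Finset V) (v : V) : #{x | v + x ∈ S} = #S := by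
  refine card_nbij' (v + ·) (-v + ·) ?_ ?_ (fun a _ => neg_add_cancel_left v a)
    fun a _ => add_neg_cancel_left v a
  · intro a ha
    simpa using ha
  · intro a ha
    simpa using ha

/-- The dimension six form: three sets such that no line meets all of them, two of which are caps
of size 112. -/
theorem card_le_of_transversal_free (hV : Fintype.card V = 3 ^ 6) {A B C : Finset V}
    (hA : CapSet A) (hB : CapSet B) (hAc : #A = 112) (hBc : #B = 112)
    (h : ∀ a ∈ A, ∀ b ∈ B, ∀ c ∈ C, a + b + c ≠ 0) : #C ≤ 31 := by
  obtain ⟨v, hv⟩ := exists_symm_add_left hV hA hAc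
  obtain ⟨w, hw⟩ := exists_symm_add_left hV hB hBc
  rw [← card_add_left C (-v - w)]
  refine hv.card_le hw hV (hA.add_left v) (hB.add_left w) ((card_add_left A v).trans hAc)
    ((card_add_left B w).trans hBc) fun a ha b hb c hc h0 => ?_
  simp only [mem_filter, mem_univ, true_and] at ha hb hc
  refine h _ ha _ hb _ hc ?_
  rw [← h0]
  abel

/-- If two outer slices of a cap in dimension seven have size 112, then the middle slice has at most
31 points. -/
theorem CapSet.cnt_zero_le (hV : Fintype.card V = 3 ^ 7) {S : Finset V} (hS : CapSet S)
    {u : Module.Dual (ZMod 3) V} (hu : u ≠ 0) (h1 : cnt S u 1 = 112) (h2 : cnt S u 2 = 112) :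
    cnt S u 0 ≤ 31 := by
  obtain ⟨v, hv⟩ := exists_eq_one hu
  have hcard (i : ZMod 3) : #(CapSlice.kerSlice S u (i • v)) = cnt S u i := by
    rw [card_kerSlice, map_smul, hv, smul_eq_mul, mul_one]
  rw [← hcard] at h1 h2 ⊢
  refine card_le_of_transversal_free (card_ker hV hu) (hS.kerSlice u _) (hS.kerSlice u _) h1 h2 ?_
  rintro a ha b hb c hc h
  simp only [CapSlice.kerSlice, mem_filter, mem_univ, true_and] at ha hb hc
  obtain ⟨h3, -⟩ := hS _ ha _ hb _ hc (by
    have h' := congrArg Subtype.val h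
    simp only [Submodule.coe_add, Submodule.coe_zero] at h'
    refine Eq.trans ?_ ((congrArg₂ (· + ·) (add_self_add_self v) h').trans (add_zero 0))
    rw [one_smul, zero_smul, show (2 : ZMod 3) = 1 + 1 from rfl, add_smul, one_smul]
    abel)
  have := congrArg u h3
  rw [map_add, map_add, LinearMap.mem_ker.1 a.2, LinearMap.mem_ker.1 b.2, map_smul, map_smul, hv]
    at this
  revert this
  decide

end Middle

end CapSlice

theorem IsCap.capSet {n : ℕ} {S : Finset (Fin n → ZMod 3)} (hS : IsCap S) : CapSlice.CapSet S := by
  intro a ha b hb c hc h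
  have key {a b : Fin n → ZMod 3} (h : a + a + b = 0) : b = a := by
    rw [← sub_eq_zero, ← sub_eq_zero.2 (h.trans (CapSlice.add_self_add_self a).symm)]
    abel
  by_cases hab : a = b
  · subst hab
    exact ⟨rfl, (key h).symm⟩
  by_cases hac : a = c
  · subst hac
    exact absurd (key (by rw [← h]; abel)).symm hab
  by_cases hbc : b = c
  · subst hbc
    exact absurd (key (by rw [← h]; abel)) hab
  exact absurd h (hS a ha b hb c hc hab hac hbc)

/-- If two parallel hyperplane slices of a 7-dimensional cap each have 112 points,
then the middle slice has at most 34 points. -/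
theorem middle_slice_le_34 (S : Finset (Fin 7 → ZMod 3)) (hS : IsCap S)
    (ℓ : (Fin 7 → ZMod 3) →ₗ[ZMod 3] ZMod 3) (hℓ : ℓ ≠ 0)
    (h1 : (S.filter fun x => ℓ x = 1).card = 112)
    (h2 : (S.filter fun x => ℓ x = 2).card = 112) :
    (S.filter fun x => ℓ x = 0).card ≤ 34 := by
  exact (hS.capSet.cnt_zero_le (by simp) hℓ h1 h2).trans (by decide)
end

section
/- There exists a complete cap of size 96 in F = (Fin 6 → ZMod 3): a cap S with |S| = 96 such that S ∪ {p} is not a cap for any point p ∈ F \ S; moreover S can be chosen together with a nonzero linear functional ℓ such that the slices S ∩ ℓ⁻¹(1) and S ∩ ℓ⁻¹(2) each have exactly 45 points, the slice S ∩ ℓ⁻¹(0) has exactly 6 points, and no point reflection x ↦ c − x (with ℓ(c) = 0) maps S ∩ ℓ⁻¹(1) onto S ∩ ℓ⁻¹(2). -/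
open Finset

/-- The base-three code `∑ i, x i * 3 ^ i` of a point of affine space over `ZMod 3`. -/
def ternaryCode {n : ℕ} (x : Fin n → ZMod 3) : ℕ := ∑ i, (x i).val * 3 ^ (i : ℕ)

/-- The code of the third point `-x - y` of the line through `x` and `y`, computed from the
codes of `x` and `y` digit by digit. -/
def thirdCode : ℕ → ℕ → ℕ → ℕ
  | 0, _, _ => 0
  | n + 1, a, b => 2 * (a + b) % 3 + 3 * thirdCode n (a / 3) (b / 3)

theorem ternaryCode_succ {n : ℕ} (x : Fin (n + 1) → ZMod 3) :
    ternaryCode x = (x 0).val + 3 * ternaryCode (fun i => x i.succ) := by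
  simp only [ternaryCode, Fin.sum_univ_succ, mul_sum, Fin.val_zero, pow_zero, mul_one,
    Fin.val_succ, pow_succ]
  congr 1
  exact sum_congr rfl fun i _ => by ring

theorem ternaryCode_mod_three {n : ℕ} (x : Fin (n + 1) → ZMod 3) :
    ternaryCode x % 3 = (x 0).val := by
  have := ZMod.val_lt (x 0)
  rw [ternaryCode_succ]
  omega

theorem ternaryCode_neg_sub {n : ℕ} (x y : Fin n → ZMod 3) :
    ternaryCode (-x - y) = thirdCode n (ternaryCode x) (ternaryCode y) := by
  induction n with
  | zero => simp [ternaryCode, thirdCode]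
  | succ n ih =>
    have hx := ZMod.val_lt (x 0)
    have hy := ZMod.val_lt (y 0)
    have digit : ∀ u v : ZMod 3, (-u - v).val = 2 * (u.val + v.val) % 3 := by decide
    have tail : ternaryCode (fun i : Fin n => -x i.succ - y i.succ) = _ :=
      ih (fun i => x i.succ) (fun i => y i.succ)
    have hx' := ternaryCode_succ x
    have hy' := ternaryCode_succ y
    have dx : ternaryCode x / 3 = ternaryCode (fun i => x i.succ) := by omega
    have dy : ternaryCode y / 3 = ternaryCode (fun i => y i.succ) := by omega
    have head := digit (x 0) (y 0)
    rw [thirdCode, dx, dy, ← tail, ternaryCode_succ (-x - y)]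
    simp only [Pi.sub_apply, Pi.neg_apply]
    omega

theorem ternaryCode_eq_finFunctionFinEquiv {n : ℕ} (x : Fin n → ZMod 3) :
    ternaryCode x = (finFunctionFinEquiv (m := 3) x : ℕ) :=
  (finFunctionFinEquiv_apply (m := 3) x).symm

theorem ternaryCode_lt {n : ℕ} (x : Fin n → ZMod 3) : ternaryCode x < 3 ^ n := by
  rw [ternaryCode_eq_finFunctionFinEquiv]
  exact Fin.is_lt _

theorem ternaryCode_injective {n : ℕ} :
    Function.Injective (ternaryCode : (Fin n → ZMod 3) → ℕ) := fun x y h => by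
  rw [ternaryCode_eq_finFunctionFinEquiv, ternaryCode_eq_finFunctionFinEquiv] at h
  exact (finFunctionFinEquiv (m := 3)).injective (Fin.ext h)

theorem exists_ternaryCode_eq {n a : ℕ} (h : a < 3 ^ n) :
    ∃ x : Fin n → ZMod 3, ternaryCode x = a :=
  ⟨(finFunctionFinEquiv (m := 3)).symm ⟨a, h⟩,
    (ternaryCode_eq_finFunctionFinEquiv _).trans
      (congrArg Fin.val ((finFunctionFinEquiv (m := 3)).apply_symm_apply ⟨a, h⟩))⟩

/-- The number whose set binary digits are at the positions in a list. -/
def bitMask (L : List ℕ) : ℕ := L.foldr (fun a m => 2 ^ a ||| m) 0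

theorem testBit_bitMask {L : List ℕ} {a : ℕ} : (bitMask L).testBit a = true ↔ a ∈ L := by
  induction L with
  | nil => simp [bitMask]
  | cons b L ih =>
    change (2 ^ b ||| bitMask L).testBit a = true ↔ _
    rw [Nat.testBit_or, Bool.or_eq_true, Nat.testBit_two_pow, decide_eq_true_iff, ih,
      List.mem_cons, eq_comm]

/-- The finite set of points whose codes lie in a list. -/
def pointsOfCodes (n : ℕ) (L : List ℕ) : Finset (Fin n → ZMod 3) :=
  univ.filter fun x => ternaryCode x ∈ L

theorem mem_pointsOfCodes {n : ℕ} {L : List ℕ} {x : Fin n → ZMod 3} :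
    x ∈ pointsOfCodes n L ↔ ternaryCode x ∈ L := by
  simp [pointsOfCodes]

theorem card_pointsOfCodes {n : ℕ} {L : List ℕ} (nodup : L.Nodup) (lt : ∀ a ∈ L, a < 3 ^ n) :
    (pointsOfCodes n L).card = L.length := by
  rw [← List.toFinset_card_of_nodup nodup]
  refine card_bij (fun x _ => ternaryCode x) ?_ (fun _ _ _ _ h => ternaryCode_injective h) ?_
  · intro x hx
    simpa using mem_pointsOfCodes.1 hx
  · intro a ha
    rw [List.mem_toFinset] at ha
    obtain ⟨x, rfl⟩ := exists_ternaryCode_eq (lt a ha)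
    exact ⟨x, mem_pointsOfCodes.2 ha, rfl⟩

theorem filter_pointsOfCodes {n : ℕ} (L : List ℕ) (r : ZMod 3) :
    ((pointsOfCodes (n + 1) L).filter fun x => x 0 = r) =
      pointsOfCodes (n + 1) (L.filter fun a => a % 3 = r.val) := by
  ext x
  simp [mem_pointsOfCodes, ternaryCode_mod_three, (ZMod.val_injective 3).eq_iff]

theorem isCap_pointsOfCodes {n : ℕ} {L : List ℕ}
    (h : ∀ a ∈ L, ∀ b ∈ L, a ≠ b → (bitMask L).testBit (thirdCode n a b) = false) :
    IsCap (pointsOfCodes n L) := by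
  intro a ha b hb c hc hab _ _ hsum
  rw [mem_pointsOfCodes] at ha hb hc
  refine Bool.eq_false_iff.1 (h _ ha _ hb (ternaryCode_injective.ne hab)) (testBit_bitMask.2 ?_)
  rwa [← ternaryCode_neg_sub, show -a - b = c by linear_combination -hsum]

theorem not_isCap_insert_pointsOfCodes {n : ℕ} {L : List ℕ}
    (lt : ∀ a ∈ L, a < 3 ^ n)
    (h : ∀ d < 3 ^ n, (bitMask L).testBit d = false →
      ∃ a ∈ L, a ≠ thirdCode n d a ∧ (bitMask L).testBit (thirdCode n d a) = true)
    {p : Fin n → ZMod 3} (hp : p ∉ pointsOfCodes n L) :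
    ¬ IsCap (insert p (pointsOfCodes n L)) := by
  intro cap
  rw [mem_pointsOfCodes] at hp
  obtain ⟨a, ha, hne, hmem⟩ := h _ (ternaryCode_lt p)
    (Bool.eq_false_iff.2 (testBit_bitMask.not.2 hp))
  obtain ⟨x, rfl⟩ := exists_ternaryCode_eq (lt a ha)
  rw [testBit_bitMask] at hmem
  rw [← ternaryCode_neg_sub] at hne hmem
  refine cap p (mem_insert_self _ _) x (mem_insert_of_mem (mem_pointsOfCodes.2 ha)) (-p - x)
    (mem_insert_of_mem (mem_pointsOfCodes.2 hmem)) ?_ ?_ (fun e => hne (congrArg _ e)) (by abel)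
  · rintro rfl
    exact hp ha
  · intro e
    exact hp (by rwa [← e] at hmem)

/-- The codes of the points of a complete 96-cap, ordered by their residues modulo three. -/
def capCodes : List ℕ :=
  [189, 192, 309, 375, 429, 561, 13, 16, 22, 37, 46, 64, 97, 103, 109, 115, 136, 139, 175,
   190, 193, 247, 274, 280, 325, 334, 376, 394, 400, 403, 448, 454, 457, 472, 475, 481,
   490, 493, 520, 532, 544, 550, 568, 586, 646, 649, 658, 700, 718, 724, 727, 17, 38, 44,
   56, 62, 65, 80, 86, 89, 95, 110, 116, 122, 131, 203, 221, 224, 230, 284, 287, 302, 311,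
   359, 365, 395, 398, 431, 491, 515, 521, 536, 539, 545, 563, 572, 584, 596, 617, 632,
   638, 647, 659, 683, 707, 719]

theorem lt_of_mem_capCodes : ∀ a ∈ capCodes, a < 3 ^ 6 := by decide +kernel

theorem nodup_capCodes : capCodes.Nodup := by decide +kernel

/-- The bit mask of `capCodes`. -/
def capMask : ℕ :=
  798391343641584092886838009478988536450680658443619339645634356190854853969817866553456813182886710382126275195138275137801939756222082925378884764931616584282724576224576828926195763578983494958783173327274841647292416

theorem bitMask_capCodes : bitMask capCodes = capMask := by decide +kernel

theorem thirdCode_notMem_capCodes : ∀ a ∈ capCodes, ∀ b ∈ capCodes, a ≠ b →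
    capMask.testBit (thirdCode 6 a b) = false := by
  decide +kernel

theorem exists_secant_capCodes : ∀ d < 3 ^ 6, capMask.testBit d = false →
    ∃ a ∈ capCodes, a ≠ thirdCode 6 d a ∧ capMask.testBit (thirdCode 6 d a) = true := by
  decide +kernel

theorem exists_reflection_notMem_capCodes : ∀ d < 3 ^ 6, d % 3 = 0 →
    ∃ a ∈ capCodes, a % 3 = 1 ∧ capMask.testBit (thirdCode 6 d a) = false := by
  decide +kernel

theorem length_filter_capCodes : ∀ r : ZMod 3,
    (capCodes.filter fun a => a % 3 = r.val).length = if r = 0 then 6 else 45 := by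
  decide +kernel

theorem card_filter_pointsOfCodes_capCodes (r : ZMod 3) :
    ((pointsOfCodes 6 capCodes).filter fun x => x 0 = r).card = if r = 0 then 6 else 45 := by
  rw [filter_pointsOfCodes, ← length_filter_capCodes]
  exact card_pointsOfCodes (nodup_capCodes.filter _)
    fun a ha => lt_of_mem_capCodes a (List.mem_of_mem_filter ha)

/-- There is a complete 96-cap 6-flat, with a hyperplane direction in which the slices
have 45, 6, and 45 points and the two 45-point slices are not point reflections
of each other. -/
theorem exists_complete_96_cap :
    ∃ (S : Finset (Fin 6 → ZMod 3)) (ℓ : (Fin 6 → ZMod 3) →ₗ[ZMod 3] ZMod 3),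
      IsCap S ∧ S.card = 96 ∧
      (∀ p : Fin 6 → ZMod 3, p ∉ S → ¬ IsCap (insert p S)) ∧
      ℓ ≠ 0 ∧
      (S.filter fun x => ℓ x = 1).card = 45 ∧
      (S.filter fun x => ℓ x = 2).card = 45 ∧
      (S.filter fun x => ℓ x = 0).card = 6 ∧
      ¬ ∃ c : Fin 6 → ZMod 3, ℓ c = 0 ∧
        (S.filter fun x => ℓ x = 2) = (S.filter fun x => ℓ x = 1).image (fun x => c - x) := by
  refine ⟨pointsOfCodes 6 capCodes, LinearMap.proj 0,
    isCap_pointsOfCodes (bitMask_capCodes ▸ thirdCode_notMem_capCodes),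
    card_pointsOfCodes nodup_capCodes lt_of_mem_capCodes,
    fun p => not_isCap_insert_pointsOfCodes lt_of_mem_capCodes
      (bitMask_capCodes ▸ exists_secant_capCodes),
    fun h => ?_, (card_filter_pointsOfCodes_capCodes 1).trans (if_neg (by decide)),
    (card_filter_pointsOfCodes_capCodes 2).trans (if_neg (by decide)),
    (card_filter_pointsOfCodes_capCodes 0).trans (if_pos rfl), ?_⟩
  · simpa using LinearMap.congr_fun h 1
  · rintro ⟨c, hc, himage⟩
    simp only [LinearMap.proj_apply] at hc himage
    have hd : ternaryCode (-c) % 3 = 0 := by simp [ternaryCode_mod_three, hc]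
    obtain ⟨a, ha, ha1, hnot⟩ :=
      exists_reflection_notMem_capCodes _ (ternaryCode_lt (-c)) hd
    obtain ⟨x, rfl⟩ := exists_ternaryCode_eq (lt_of_mem_capCodes a ha)
    rw [← bitMask_capCodes, ← ternaryCode_neg_sub, neg_neg] at hnot
    have hx : x 0 = 1 := ZMod.val_injective 3 ((ternaryCode_mod_three x).symm.trans ha1)
    have hmem := himage.symm.subset (mem_image_of_mem (fun y => c - y)
      (mem_filter.2 ⟨mem_pointsOfCodes.2 ha, hx⟩))
    exact Bool.eq_false_iff.1 hnot
      (testBit_bitMask.2 (mem_pointsOfCodes.1 (mem_filter.1 hmem).1))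
end
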